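/- Let −1/6 < s < 0. For every sufficiently small ε > 0 there exist b ∈ (1/2,1) and C > 0 such that for all N ≥ 1, all K > 0, all t ∈ (0,1], and every Schwartz function u on ℝ², | ∫₀ᵗ Λ₅( (m(ξ₁)²ξ₁ + ⋯ + m(ξ₅)²ξ₅)·1_{|Φ₅| < K} ; u(σ,·) ) dσ | ≤ C · N^{−1/2+ε} · K^{1−ε} · ‖Iu‖_{X^{0,b}}⁵, where Φ₅ = ξ₁³+⋯+ξ₅³ on the set ξ₁+⋯+ξ₅ = 0. -/

import Mathlib

open MeasureTheory

noncomputable section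

/-- 1D Fourier transform  f̂(ξ) = ∫ e^{-ixξ} f(x) dx. -/
def FTs (f : ℝ → ℂ) (ξ : ℝ) : ℂ :=
  ∫ x : ℝ, Complex.exp (-(Complex.I * ((x * ξ : ℝ) : ℂ))) * f x

/-- Extend a vector of `n-1` frequencies to `n` frequencies summing to zero. -/
def padZero (n : ℕ) (v : Fin (n - 1) → ℝ) : Fin n → ℝ :=
  fun j => if h : (j : ℕ) < n - 1 then v ⟨j, h⟩ else -(∑ i, v i)

/-- Multilinear functional Λ_n(M; f) = ∫_{ξ₁+⋯+ξ_n=0} M ∏ f̂(ξ_j). -/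
def Lam (n : ℕ) (M : (Fin n → ℝ) → ℂ) (f : ℝ → ℂ) : ℂ :=
  ∫ v : Fin (n - 1) → ℝ, M (padZero n v) * ∏ j, FTs f (padZero n v j)

/-- The I-method multiplier m. -/
def mI (s N ξ : ℝ) : ℝ := if |ξ| ≤ N then 1 else (|ξ| / N) ^ s

/-- Spacetime Fourier transform on ℝ². -/
def FT2 (u : ℝ × ℝ → ℂ) (τ ξ : ℝ) : ℂ :=
  ∫ p : ℝ × ℝ, Complex.exp (-(Complex.I * ((p.1 * τ + p.2 * ξ : ℝ) : ℂ))) * u p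

/-- The modified Bourgain norm ‖Iu‖_{X^{0,b}}. -/
def XnormI (s N b : ℝ) (u : ℝ × ℝ → ℂ) : ℝ :=
  Real.sqrt (∫ q : ℝ × ℝ,
    mI s N q.2 ^ 2 * (1 + (q.1 - q.2 ^ 3) ^ 2) ^ b * ‖FT2 u q.1 q.2‖ ^ 2)

lemma frequency_geometry_aux {x0 x1 x2 x3 x4 A : ℝ} (hsum : x0 + x1 + x2 + x3 + x4 = 0)
    (hA : 0 < A) (h0 : x0 = A) (h12 : |x2| ≤ |x1|) (h23 : |x3| ≤ |x2|)
    (h34 : |x4| ≤ |x3|) (hfar : |x1| - |x4| < A / 50) :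
    |x1| ≤ 3 / 5 * A := by
  by_contra! hc
  have : 14/25 * A < |x4| := by linarith
  rcases abs_cases x1 with ⟨e1, g1⟩ | ⟨e1, g1⟩ <;> rcases abs_cases x2 with ⟨e2, g2⟩ | ⟨e2, g2⟩ <;>
  rcases abs_cases x3 with ⟨e3, g3⟩ | ⟨e3, g3⟩ <;> rcases abs_cases x4 with ⟨e4, g4⟩ | ⟨e4, g4⟩ <;>
  linarith

lemma cube_sum_large {x0 x1 x2 x3 x4 A : ℝ} (hsum : x0 + x1 + x2 + x3 + x4 = 0)
    (hA : 0 < A) (h0 : |x0| = A) (h01 : |x1| ≤ A) (h12 : |x2| ≤ |x1|) (h23 : |x3| ≤ |x2|)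
    (h34 : |x4| ≤ |x3|) (hfar : |x1| - |x4| < A / 50) :
    A ^ 3 ≤ 4 * |x0 ^ 3 + x1 ^ 3 + x2 ^ 3 + x3 ^ 3 + x4 ^ 3| ∧ A ^ 2 ≤ 4 * |x0 ^ 2 - x1 ^ 2| := by
  wlog hx : 0 ≤ x0 generalizing x0 x1 x2 x3 x4
  · have := @this (-x0) (-x1) (-x2) (-x3) (-x4) (by linarith) (by simpa) (by simpa) (by simpa)
      (by simpa) (by simpa) (by simpa) (by linarith)
    have e : (-x0) ^ 3 + (-x1) ^ 3 + (-x2) ^ 3 + (-x3) ^ 3 + (-x4) ^ 3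
        = -(x0 ^ 3 + x1 ^ 3 + x2 ^ 3 + x3 ^ 3 + x4 ^ 3) := by ring
    rw [e, abs_neg] at this
    simpa using this
  rw [abs_of_nonneg hx] at h0
  subst h0
  have h1 := frequency_geometry_aux hsum hA rfl h12 h23 h34 hfar
  have key : ∀ y : ℝ, |y| ≤ |x1| → |x1| - |y| < x0 / 50 →
      |x1| ^ 2 * y - x0 ^ 3 / 25 ≤ y ^ 3 := by
    intro y hy hy'
    have h2 : 0 ≤ |x1| ^ 2 - y ^ 2 := by
      rw [← sq_abs y]; nlinarith [abs_nonneg y]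
    have h3 : |x1| ^ 2 - y ^ 2 ≤ x0 ^ 2 / 25 := by
      rw [← sq_abs y]
      have : |x1| + |y| ≤ 2 * x0 := by linarith
      nlinarith [abs_nonneg y, abs_nonneg x1]
    have h4 : y ≤ x0 := (le_abs_self y).trans (hy.trans h01)
    nlinarith
  have k1 := key x1 le_rfl (by linarith)
  have k2 := key x2 h12 (by linarith)
  have k3 := key x3 (h23.trans h12) (by linarith)
  have k4 := key x4 (h34.trans (h23.trans h12)) (by linarith)
  have h5 : |x1| ^ 2 ≤ 9 / 25 * x0 ^ 2 := by nlinarith [abs_nonneg x1]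
  constructor
  · have : |x1| ^ 2 * (x1 + x2 + x3 + x4) = - (|x1| ^ 2 * x0) := by
      rw [show x1 + x2 + x3 + x4 = -x0 by linarith]; ring
    have h6 : |x1| ^ 2 * x0 ≤ 9 / 25 * x0 ^ 3 := by nlinarith
    refine le_trans ?_ (mul_le_mul_of_nonneg_left (le_abs_self _) (by norm_num))
    nlinarith [pow_pos hA 3]
  · refine le_trans ?_ (mul_le_mul_of_nonneg_left (le_abs_self _) (by norm_num))
    rw [sq_abs] at h5
    nlinarith

/-- Four frequencies of nearly maximal modulus split into two pairs of opposite signs. -/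
lemma opposite_pair_bound {a b c e A : ℝ} (hA : 0 < A)
    (ha : 49 / 50 * A < |a|) (hb : 49 / 50 * A < |b|) (hc : 49 / 50 * A < |c|)
    (he : |e| ≤ 4 / 50 * A) (hab : a * b < 0) :
    |a + b| * A ^ 3 ≤ 2 * (|a ^ 2 - b ^ 2| * |c ^ 2 - e ^ 2|) := by
  have h1 : A ≤ |a - b| := by
    rcases mul_neg_iff.1 hab with ⟨p, q⟩ | ⟨p, q⟩
    · rw [abs_of_pos p] at ha; rw [abs_of_neg q] at hb
      exact le_trans (by linarith) (le_abs_self _)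
    · rw [abs_of_neg p] at ha; rw [abs_of_pos q] at hb
      have := neg_le_abs (a - b)
      linarith
  have h2 : A ^ 2 / 2 ≤ |c ^ 2 - e ^ 2| := by
    refine le_trans ?_ (le_abs_self _)
    rw [← sq_abs c, ← sq_abs e]
    nlinarith [abs_nonneg e]
  have h3 : |a ^ 2 - b ^ 2| = |a + b| * |a - b| := by rw [← abs_mul]; ring_nf
  rw [h3]
  have h4 : A * (A ^ 2 / 2) ≤ |a - b| * |c ^ 2 - e ^ 2| := by gcongr
  nlinarith [abs_nonneg (a + b)]

lemma exists_opposite_pairs {x0 x1 x2 x3 x4 A : ℝ} (hsum : x0 + x1 + x2 + x3 + x4 = 0)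
    (hA : 0 < A) (h0 : |x0| = A) (h01 : |x1| ≤ A) (h12 : |x2| ≤ |x1|) (h23 : |x3| ≤ |x2|)
    (h34 : |x4| ≤ |x3|) (hnear : A - |x3| < A / 50) :
    |x4| ≤ 4 / 50 * A ∧ ((x0 * x1 < 0 ∧ x2 * x3 < 0) ∨ (x0 * x2 < 0 ∧ x1 * x3 < 0)) := by
  have H3 : 49 / 50 * A < |x3| := by linarith
  have H2 : 49 / 50 * A < |x2| := by linarith
  have H1 : 49 / 50 * A < |x1| := by linarith
  have H0 : 49 / 50 * A < |x0| := by linarith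
  have hneg : ∀ {p q : ℝ}, 49 / 50 * A < p → q < - (49 / 50 * A) → p * q < 0 := by
    intro p q hp hq; exact mul_neg_of_pos_of_neg (by linarith) (by linarith)
  have hneg' : ∀ {p q : ℝ}, 49 / 50 * A < p → q < - (49 / 50 * A) → q * p < 0 := by
    intro p q hp hq; exact mul_neg_of_neg_of_pos (by linarith) (by linarith)
  have h4A : |x4| ≤ A := by linarith
  have u0 := h0.le
  have u2 : |x2| ≤ A := by linarith
  have u3 : |x3| ≤ A := by linarith
  clear h34 h23 h12 hnear h0
  rw [abs_le] at h4A u0 h01 u2 u3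
  rw [lt_abs] at H0 H1 H2 H3
  rcases H0 with H0 | H0 <;> rcases H1 with H1 | H1 <;> rcases H2 with H2 | H2 <;>
    rcases H3 with H3 | H3 <;> first
    | (exfalso; linarith)
    | (refine ⟨abs_le.2 ⟨by linarith, by linarith⟩, ?_⟩
       first
       | exact Or.inl ⟨by first | exact hneg H0 (by linarith) | exact hneg' H1 (by linarith),
           by first | exact hneg H2 (by linarith) | exact hneg' H3 (by linarith)⟩
       | exact Or.inr ⟨by first | exact hneg H0 (by linarith) | exact hneg' H2 (by linarith),
           by first | exact hneg H1 (by linarith) | exact hneg' H3 (by linarith)⟩)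

lemma two_transversal_pairs {x0 x1 x2 x3 x4 A : ℝ} (hsum : x0 + x1 + x2 + x3 + x4 = 0)
    (hA : 0 < A) (h0 : |x0| = A) (h12 : |x2| ≤ |x1|) (h23 : |x3| ≤ |x2|)
    (h03 : A / 50 ≤ A - |x3|) (h14 : A / 50 ≤ |x1| - |x4|) :
    A ^ 2 / 50 * (A ^ 2 / 200) ≤ |x0 ^ 2 - x3 ^ 2| * |x1 ^ 2 - x4 ^ 2| := by
  have l1 : A / 4 ≤ |x1| := by
    have : A ≤ |x1| + |x2| + |x3| + |x4| := by
      rw [← h0, show x0 = -(x1 + x2 + x3 + x4) by linarith, abs_neg]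
      linarith [abs_add_le (x1 + x2 + x3) x4, abs_add_le (x1 + x2) x3, abs_add_le x1 x2]
    linarith
  have d1 : A ^ 2 / 50 ≤ |x0 ^ 2 - x3 ^ 2| := by
    refine le_trans ?_ (le_abs_self _)
    rw [← sq_abs x0, ← sq_abs x3, h0]
    nlinarith [mul_le_mul_of_nonneg_right h03 (add_nonneg hA.le (abs_nonneg x3)),
      mul_nonneg hA.le (abs_nonneg x3)]
  have d2 : A ^ 2 / 200 ≤ |x1 ^ 2 - x4 ^ 2| := by
    refine le_trans ?_ (le_abs_self _)
    rw [← sq_abs x1, ← sq_abs x4]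
    have : A / 50 * (A / 4) ≤ (|x1| - |x4|) * (|x1| + |x4|) := by
      have := abs_nonneg x4
      exact mul_le_mul h14 (by linarith) (by positivity) (by linarith)
    nlinarith
  exact mul_le_mul d1 d2 (by positivity) (abs_nonneg _)

/-- The ratio `max(1, |ξ|/N)`. -/
def freqRatio (N ξ : ℝ) : ℝ := max 1 (|ξ| / N)

/-- The weight `N^{-p} max(1, |ξ|/N)^{-r}`. -/
def freqWeight (p r N ξ : ℝ) : ℝ := N ^ (-p) * freqRatio N ξ ^ (-r)

lemma one_le_freqRatio (N ξ : ℝ) : 1 ≤ freqRatio N ξ := le_max_left _ _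

lemma freqRatio_pos (N ξ : ℝ) : 0 < freqRatio N ξ := zero_lt_one.trans_le (one_le_freqRatio N ξ)

lemma freqRatio_mono {N x y : ℝ} (hN : 0 < N) (h : |x| ≤ |y|) :
    freqRatio N x ≤ freqRatio N y := by
  unfold freqRatio; gcongr

lemma mI_eq_freqRatio_rpow {s N : ℝ} (hN : 0 < N) (ξ : ℝ) : mI s N ξ = freqRatio N ξ ^ s := by
  unfold mI freqRatio
  split_ifs with h
  · rw [max_eq_left ((div_le_one hN).2 h), Real.one_rpow]
  · rw [max_eq_right ((one_le_div hN).2 (not_le.1 h).le)]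

lemma mI_pos {s N : ℝ} (hN : 0 < N) (ξ : ℝ) : 0 < mI s N ξ := by
  rw [mI_eq_freqRatio_rpow hN]; exact Real.rpow_pos_of_pos (freqRatio_pos _ _) _

lemma mI_anti {s N x y : ℝ} (hs : s ≤ 0) (hN : 0 < N) (h : |x| ≤ |y|) :
    mI s N y ≤ mI s N x := by
  rw [mI_eq_freqRatio_rpow hN, mI_eq_freqRatio_rpow hN]
  exact Real.rpow_le_rpow_of_nonpos (freqRatio_pos _ _) (freqRatio_mono hN h) hs

lemma mI_le_one {s N : ℝ} (hs : s ≤ 0) (hN : 0 < N) (ξ : ℝ) : mI s N ξ ≤ 1 := by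
  rw [mI_eq_freqRatio_rpow hN]
  exact Real.rpow_le_one_of_one_le_of_nonpos (one_le_freqRatio _ _) hs

lemma mI_neg (s N ξ : ℝ) : mI s N (-ξ) = mI s N ξ := by
  unfold mI; rw [abs_neg]

lemma mI_pow_four_mul_mono {s N x y : ℝ} (hs : -(1 / 4) ≤ s) (hN : 0 < N)
    (h : |x| ≤ |y|) : mI s N x ^ 4 * |x| ≤ mI s N y ^ 4 * |y| := by
  by_cases hy : |y| ≤ N
  · have hx : |x| ≤ N := h.trans hy
    unfold mI; rw [if_pos hx, if_pos hy]; linarith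
  · push Not at hy
    have e : ∀ z, N ≤ |z| → mI s N z ^ 4 * |z| = N * freqRatio N z ^ (4 * s + 1) := by
      intro z hz
      have hr : |z| = N * freqRatio N z := by
        unfold freqRatio; rw [max_eq_right ((one_le_div hN).2 hz)]; field_simp
      rw [mI_eq_freqRatio_rpow hN, Real.rpow_add (freqRatio_pos _ _), Real.rpow_one,
        ← Real.rpow_natCast, ← Real.rpow_mul (freqRatio_pos _ _).le]
      rw [hr]
      push_cast
      rw [mul_comm s 4]; ring
    rcases le_total |x| N with hx | hx
    · have h1 : mI s N x = 1 := by unfold mI; rw [if_pos hx]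
      rw [h1, e y hy.le]
      have : 1 ≤ freqRatio N y ^ (4 * s + 1) :=
        Real.one_le_rpow (one_le_freqRatio _ _) (by linarith)
      nlinarith
    · rw [e x hx, e y hy.le]
      have := Real.rpow_le_rpow (freqRatio_pos N x).le (freqRatio_mono hN h)
        (show 0 ≤ 4 * s + 1 by linarith)
      nlinarith

lemma mI_sq_mul_sq_le {s N x A : ℝ} (hs : -(1 / 4) ≤ s) (hN : 0 < N)
    (hA : 0 ≤ A) (h : |x| ≤ A) : (mI s N x ^ 2 * x) ^ 2 ≤ mI s N A ^ 4 * A * |x| := by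
  have := mI_pow_four_mul_mono hs hN (h.trans (le_abs_self A))
  rw [abs_of_nonneg hA] at this
  calc (mI s N x ^ 2 * x) ^ 2 = mI s N x ^ 4 * |x| * |x| := by
        rw [mul_pow, ← sq_abs x]; ring
    _ ≤ _ := by gcongr

lemma mI_sq_mul_mono {s N x y : ℝ} (hs : -(1 / 4) ≤ s) (hN : 0 < N)
    (h : |x| ≤ |y|) : mI s N x ^ 2 * |x| ≤ mI s N y ^ 2 * |y| := by
  have := mI_pow_four_mul_mono hs hN h
  have h4 : 0 ≤ mI s N y ^ 4 := by positivity
  refine abs_le_of_sq_le_sq' ?_ (by positivity) |>.2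
  calc (mI s N x ^ 2 * |x|) ^ 2 = mI s N x ^ 4 * |x| * |x| := by ring
    _ ≤ mI s N y ^ 4 * |y| * |y| := by gcongr
    _ = _ := by ring

lemma mI_add_sq_le {s N x y A : ℝ} (hs : -(1 / 4) ≤ s) (hs0 : s ≤ 0) (hN : 0 < N)
    (hx : |x| ≤ A) (hy : |y| ≤ A) :
    (mI s N x ^ 2 * x + mI s N y ^ 2 * y) ^ 2 ≤ 2 * (mI s N A ^ 4 * A * |x + y|) := by
  have hA : 0 ≤ A := (abs_nonneg x).trans hx
  wlog hxy : |y| ≤ |x| generalizing x y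
  · rw [add_comm, add_comm x y]; exact this hy hx (not_le.1 hxy).le
  wlog hx0 : 0 ≤ x generalizing x y
  · have := @this (-x) (-y) (by simpa) (by simpa) (by simpa) (by linarith)
    rw [mI_neg, mI_neg, show -x + -y = -(x + y) by ring, abs_neg] at this
    convert this using 1; ring
  have h4 : 0 ≤ mI s N A ^ 4 * A := by positivity
  rcases le_total 0 y with h | h
  · have h1 := mI_sq_mul_sq_le hs hN hA hx
    have h2 := mI_sq_mul_sq_le hs hN hA hy
    rw [abs_of_nonneg (add_nonneg hx0 h)]
    rw [abs_of_nonneg hx0] at h1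
    rw [abs_of_nonneg h] at h2
    nlinarith [sq_nonneg (mI s N x ^ 2 * x - mI s N y ^ 2 * y)]
  · rw [abs_of_nonneg hx0, abs_of_nonpos h] at hxy
    have h0 : 0 ≤ x + y := by linarith
    have h1 := mI_sq_mul_sq_le hs hN hA (x := x + y)
      (by rw [abs_of_nonneg h0]; linarith [le_abs_self x])
    have h2 : 0 ≤ mI s N x ^ 2 * x + mI s N y ^ 2 * y := by
      have := mI_sq_mul_mono (x := y) (y := x) hs hN
        (by rwa [abs_of_nonneg hx0, abs_of_nonpos h])
      rw [abs_of_nonneg hx0, abs_of_nonpos h] at this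
      linarith
    have h3 : mI s N x ^ 2 * x + mI s N y ^ 2 * y ≤ mI s N (x + y) ^ 2 * (x + y) := by
      have a1 : mI s N x ^ 2 ≤ mI s N (x + y) ^ 2 :=
        pow_le_pow_left₀ (mI_pos hN _).le (mI_anti hs0 hN
          (by rw [abs_of_nonneg h0, abs_of_nonneg hx0]; linarith)) 2
      have a2 : mI s N x ^ 2 ≤ mI s N y ^ 2 :=
        pow_le_pow_left₀ (mI_pos hN _).le (mI_anti hs0 hN
          (by rwa [abs_of_nonneg hx0, abs_of_nonpos h])) 2
      nlinarith
    calc _ ≤ (mI s N (x + y) ^ 2 * (x + y)) ^ 2 := by gcongr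
      _ ≤ _ := h1
      _ ≤ _ := by nlinarith [mul_nonneg h4 (abs_nonneg (x + y))]

lemma multiplier_sq_le_of_pairs {s N A a b c d e : ℝ} (hs : -(1 / 4) ≤ s) (hs0 : s ≤ 0)
    (hN : 0 < N) (ha : |a| ≤ A) (hb : |b| ≤ A) (hc : |c| ≤ A) (hd : |d| ≤ A) (he : |e| ≤ A)
    (hsum : a + b + c + d + e = 0) (hle : |c + d| ≤ |a + b|) :
    (mI s N a ^ 2 * a + mI s N b ^ 2 * b + mI s N c ^ 2 * c + mI s N d ^ 2 * d
      + mI s N e ^ 2 * e) ^ 2 ≤ 18 * (mI s N A ^ 4 * A * |a + b|) := by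
  have hA : 0 ≤ A := (abs_nonneg a).trans ha
  have h1 := mI_add_sq_le hs hs0 hN ha hb
  have h2 := mI_add_sq_le hs hs0 hN hc hd
  have h3 := mI_sq_mul_sq_le hs hN hA he
  have h4 : 0 ≤ mI s N A ^ 4 * A := by positivity
  have h5 : |e| ≤ 2 * |a + b| := by
    rw [show e = -((a + b) + (c + d)) by linarith, abs_neg]
    exact (abs_add_le _ _).trans (by linarith)
  have h6 := mul_le_mul_of_nonneg_left h5 h4
  have h7 := mul_le_mul_of_nonneg_left hle h4
  set X := mI s N a ^ 2 * a + mI s N b ^ 2 * b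
  set Y := mI s N c ^ 2 * c + mI s N d ^ 2 * d
  set Z := mI s N e ^ 2 * e
  calc _ = (X + Y + Z) ^ 2 := by simp only [X, Y, Z]; ring
    _ ≤ 3 * (X ^ 2 + Y ^ 2 + Z ^ 2) := by
      nlinarith [sq_nonneg (X - Y), sq_nonneg (Y - Z), sq_nonneg (X - Z)]
    _ ≤ _ := by linarith

/-- Kernel bounding the multiplier when two disjoint pairs of frequencies are transversal. -/
def pairKernel (s N : ℝ) (y : Fin 5 → ℝ) : ℝ :=
  √|y 1 ^ 2 - y 2 ^ 2| * √|y 3 ^ 2 - y 4 ^ 2| * freqWeight 1 (1 + 3 * s) N (y 0)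

/-- Kernel bounding the multiplier when the sum of the cubes of the frequencies is large. -/
def resonanceKernel (s N : ℝ) (y : Fin 5 → ℝ) : ℝ :=
  √|y 2 ^ 2 - y 3 ^ 2| * freqWeight (3 / 4) (3 / 4 + 3 / 2 * s) N (y 0)
    * freqWeight (3 / 4) (3 / 4 + 3 / 2 * s) N (y 1)

lemma freqWeight_pos {p r N : ℝ} (hN : 0 < N) (ξ : ℝ) : 0 < freqWeight p r N ξ :=
  mul_pos (Real.rpow_pos_of_pos hN _) (Real.rpow_pos_of_pos (freqRatio_pos _ _) _)

lemma freqWeight_anti {p r N x y : ℝ} (hN : 0 < N) (hr : 0 ≤ r) (h : |x| ≤ |y|) :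
    freqWeight p r N y ≤ freqWeight p r N x := by
  unfold freqWeight
  have := (Real.rpow_pos_of_pos hN (-p)).le
  gcongr ?_ * ?_
  exact Real.rpow_le_rpow_of_nonpos (freqRatio_pos _ _) (freqRatio_mono hN h) (by linarith)

lemma pairKernel_nonneg {s N : ℝ} (hN : 0 < N) (y : Fin 5 → ℝ) : 0 ≤ pairKernel s N y := by
  have := (freqWeight_pos (p := 1) (r := 1 + 3 * s) hN (y 0)).le
  unfold pairKernel; positivity

lemma resonanceKernel_nonneg {s N : ℝ} (hN : 0 < N) (y : Fin 5 → ℝ) :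
    0 ≤ resonanceKernel s N y := by
  have := (freqWeight_pos (p := 3 / 4) (r := 3 / 4 + 3 / 2 * s) hN (y 0)).le
  have := (freqWeight_pos (p := 3 / 4) (r := 3 / 4 + 3 / 2 * s) hN (y 1)).le
  unfold resonanceKernel; positivity

lemma freqRatio_of_le {N A : ℝ} (hN : 0 < N) (hA : N ≤ A) : N * freqRatio N A = A := by
  unfold freqRatio
  rw [abs_of_nonneg (hN.le.trans hA), max_eq_right ((one_le_div hN).2 hA)]; field_simp

lemma mI_pow_five_le_prod {s N A : ℝ} (hs0 : s ≤ 0) (hN : 0 < N) (y : Fin 5 → ℝ)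
    (hy : ∀ j, |y j| ≤ A) : mI s N A ^ 5 ≤ ∏ j, mI s N (y j) := by
  have : ∏ _j : Fin 5, mI s N A ≤ ∏ j, mI s N (y j) :=
    Finset.prod_le_prod (fun _ _ => (mI_pos hN _).le)
      (fun j _ => mI_anti hs0 hN ((hy j).trans (le_abs_self A)))
  simpa using this

lemma mI_sq_le_freqWeight_mul_prod {s N A x : ℝ} (hs : -(1 / 6) ≤ s) (hs0 : s ≤ 0) (hN : 0 < N)
    (hA : N ≤ A) (hx : |x| ≤ A) (y : Fin 5 → ℝ) (hy : ∀ j, |y j| ≤ A) :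
    mI s N A ^ 2 ≤ A * (freqWeight 1 (1 + 3 * s) N x * ∏ j, mI s N (y j)) := by
  have h1 := mI_pow_five_le_prod hs0 hN y hy
  have h2 := freqWeight_anti (p := 1) (r := 1 + 3 * s) hN (by linarith)
    (hx.trans (le_abs_self A))
  have h3 := (freqWeight_pos (p := 1) (r := 1 + 3 * s) hN A).le
  have h4 := (mI_pos (s := s) hN A).le
  have hA0 := hN.le.trans hA
  have hR := freqRatio_pos N A
  refine le_trans (le_of_eq ?_) (mul_le_mul_of_nonneg_left
    (mul_le_mul h2 h1 (by positivity) (h3.trans h2)) hA0)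
  unfold freqWeight
  nth_rw 2 [← freqRatio_of_le hN hA]
  rw [mI_eq_freqRatio_rpow hN, ← Real.rpow_natCast, ← Real.rpow_natCast,
    ← Real.rpow_mul hR.le, ← Real.rpow_mul hR.le]
  have e : freqRatio N A ^ (s * (2 : ℕ)) =
      freqRatio N A ^ (1 : ℝ) *
        (freqRatio N A ^ (-(1 + 3 * s)) * freqRatio N A ^ (s * (5 : ℕ))) := by
    rw [← Real.rpow_add hR, ← Real.rpow_add hR]; congr 1; push_cast; ring
  rw [e, Real.rpow_one, Real.rpow_neg hN.le, Real.rpow_one]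
  field_simp

lemma mI_sq_le_freqWeight_sq_mul_prod {s N A x x' : ℝ} (hs : -(1 / 6) ≤ s) (hs0 : s ≤ 0)
    (hN : 0 < N) (hA : N ≤ A) (hx : |x| ≤ A) (hx' : |x'| ≤ A) (y : Fin 5 → ℝ)
    (hy : ∀ j, |y j| ≤ A) :
    mI s N A ^ 2 ≤ √(A ^ 3) * (freqWeight (3 / 4) (3 / 4 + 3 / 2 * s) N x *
      freqWeight (3 / 4) (3 / 4 + 3 / 2 * s) N x' * ∏ j, mI s N (y j)) := by
  have h1 := mI_pow_five_le_prod hs0 hN y hy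
  have h2 := freqWeight_anti (p := 3 / 4) (r := 3 / 4 + 3 / 2 * s) hN (by linarith)
    (hx.trans (le_abs_self A))
  have h2' := freqWeight_anti (p := 3 / 4) (r := 3 / 4 + 3 / 2 * s) hN (by linarith)
    (hx'.trans (le_abs_self A))
  have h3 := (freqWeight_pos (p := 3 / 4) (r := 3 / 4 + 3 / 2 * s) hN A).le
  have h4 := (mI_pos (s := s) hN A).le
  have hA0 := hN.le.trans hA
  have hR := freqRatio_pos N A
  refine le_trans (le_of_eq ?_) (mul_le_mul_of_nonneg_left
    (mul_le_mul (mul_le_mul h2 h2' h3 (h3.trans h2)) h1 (by positivity)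
      (mul_nonneg (h3.trans h2) (h3.trans h2'))) (Real.sqrt_nonneg _))
  unfold freqWeight
  nth_rw 2 [← freqRatio_of_le hN hA]
  rw [mI_eq_freqRatio_rpow hN, Real.sqrt_eq_rpow, mul_pow, Real.mul_rpow (by positivity)
    (by positivity), ← Real.rpow_natCast, ← Real.rpow_natCast, ← Real.rpow_natCast,
    ← Real.rpow_natCast, ← Real.rpow_mul hR.le, ← Real.rpow_mul hR.le,
    ← Real.rpow_mul hR.le, ← Real.rpow_mul hN.le]
  have e : freqRatio N A ^ (s * (2 : ℕ)) =
      freqRatio N A ^ ((3 : ℕ) * (1 / 2) : ℝ) * (freqRatio N A ^ (-(3 / 4 + 3 / 2 * s)) *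
        freqRatio N A ^ (-(3 / 4 + 3 / 2 * s)) * freqRatio N A ^ (s * (5 : ℕ))) := by
    rw [← Real.rpow_add hR, ← Real.rpow_add hR, ← Real.rpow_add hR]; congr 1; push_cast; ring
  have e' : N ^ ((3 : ℕ) * (1 / 2) : ℝ) * (N ^ (-(3 / 4) : ℝ) * N ^ (-(3 / 4) : ℝ)) = 1 := by
    rw [← Real.rpow_add hN, ← Real.rpow_add hN]; norm_num
  rw [e]
  linear_combination (-(freqRatio N A ^ ((3 : ℕ) * (1 / 2) : ℝ) *
    (freqRatio N A ^ (-(3 / 4 + 3 / 2 * s)) *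
        freqRatio N A ^ (-(3 / 4 + 3 / 2 * s)) * freqRatio N A ^ (s * (5 : ℕ))))) * e'

lemma abs_multiplier_le {s N A : ℝ} (hs : -(1 / 4) ≤ s) (hN : 0 < N) (hA : 0 ≤ A)
    (y : Fin 5 → ℝ) (hy : ∀ j, |y j| ≤ A) :
    |∑ j, mI s N (y j) ^ 2 * y j| ≤ 5 * (mI s N A ^ 2 * A) := by
  refine (Finset.abs_sum_le_sum_abs _ _).trans ?_
  have : ∀ j ∈ Finset.univ, |mI s N (y j) ^ 2 * y j| ≤ mI s N A ^ 2 * A := by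
    intro j _
    rw [abs_mul, abs_of_nonneg (sq_nonneg (mI s N (y j)))]
    have := mI_sq_mul_mono hs hN ((hy j).trans (le_abs_self A))
    rwa [abs_of_nonneg hA] at this
  refine (Finset.sum_le_sum this).trans ?_
  simp

lemma abs_le_pairKernel {s N A M : ℝ} (hs : -(1 / 6) ≤ s) (hs0 : s ≤ 0) (hN : 0 < N)
    (hA : N ≤ A) (y z : Fin 5 → ℝ) (hy : ∀ j, |y j| ≤ A) (hz : |z 0| ≤ A)
    (h : M ^ 2 * A ^ 2 ≤ 500 ^ 2 * (|z 1 ^ 2 - z 2 ^ 2| * |z 3 ^ 2 - z 4 ^ 2|) * mI s N A ^ 4) :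
    |M| ≤ 500 * (∏ j, mI s N (y j)) * pairKernel s N z := by
  have hA0 : 0 < A := hN.trans_le hA
  have h1 := mI_sq_le_freqWeight_mul_prod hs hs0 hN hA hz y hy
  have h2 : |M| * A ≤ 500 * (√|z 1 ^ 2 - z 2 ^ 2| * √|z 3 ^ 2 - z 4 ^ 2|) * mI s N A ^ 2 := by
    refine abs_le_of_sq_le_sq' ?_ (by positivity) |>.2
    rw [mul_pow, sq_abs, mul_pow, mul_pow, mul_pow, Real.sq_sqrt (abs_nonneg _),
      Real.sq_sqrt (abs_nonneg _)]
    linarith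
  have h3 := h2.trans (mul_le_mul_of_nonneg_left h1 (by positivity))
  refine le_of_mul_le_mul_right (h3.trans (le_of_eq ?_)) hA0
  unfold pairKernel; ring

lemma sorted_multiplier_bound {s N K : ℝ} (hs : -(1 / 6) ≤ s) (hs0 : s ≤ 0) (hN : 0 < N)
    (y : Fin 5 → ℝ) (hsum : ∑ j, y j = 0) (hK : |∑ j, y j ^ 3| ≤ K)
    (h01 : |y 1| ≤ |y 0|) (h12 : |y 2| ≤ |y 1|) (h23 : |y 3| ≤ |y 2|) (h34 : |y 4| ≤ |y 3|)
    (hbig : N < |y 0|) :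
    ∃ e : Equiv.Perm (Fin 5), |∑ j, mI s N (y j) ^ 2 * y j| ≤ 500 * (∏ j, mI s N (y j)) *
      (pairKernel s N (y ∘ e) + √K * resonanceKernel s N (y ∘ e)) := by
  obtain ⟨A, hAdef⟩ : ∃ A, |y 0| = A := ⟨_, rfl⟩
  have hy : ∀ j, |y j| ≤ A := by intro j; fin_cases j <;> simp <;> linarith
  have hNA : N ≤ A := by linarith
  have hA : 0 < A := by linarith
  have hs' : -(1 / 4) ≤ s := by linarith
  have hprod : 0 < ∏ j, mI s N (y j) := Finset.prod_pos fun j _ => mI_pos hN _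
  have hM := abs_multiplier_le hs' hN hA.le y hy
  have hsum' := hsum
  rw [Fin.sum_univ_five] at hsum'
  have pair : ∀ e : Equiv.Perm (Fin 5), (∑ j, mI s N (y j) ^ 2 * y j) ^ 2 * A ^ 2 ≤
      500 ^ 2 * (|y (e 1) ^ 2 - y (e 2) ^ 2| * |y (e 3) ^ 2 - y (e 4) ^ 2|) * mI s N A ^ 4 →
      ∃ e : Equiv.Perm (Fin 5), |∑ j, mI s N (y j) ^ 2 * y j| ≤ 500 * (∏ j, mI s N (y j)) *
      (pairKernel s N (y ∘ e) + √K * resonanceKernel s N (y ∘ e)) := by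
    intro e he
    refine ⟨e, (abs_le_pairKernel hs hs0 hN hNA y (y ∘ e) hy (hy _) he).trans ?_⟩
    have := mul_nonneg (Real.sqrt_nonneg K) (resonanceKernel_nonneg (s := s) hN (y ∘ e))
    gcongr
    linarith
  have hμ4 : 0 ≤ mI s N A ^ 4 := by positivity
  by_cases hB2 : |y 1| - |y 4| < A / 50
  · obtain ⟨hΦ, hD⟩ := cube_sum_large hsum' hA hAdef (hy 1) h12 h23 h34 hB2
    rw [← Fin.sum_univ_five (fun j => y j ^ 3)] at hΦ
    refine ⟨Equiv.swap 0 2 * Equiv.swap 1 3, ?_⟩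
    have e0 : (Equiv.swap 0 2 * Equiv.swap 1 3 : Equiv.Perm (Fin 5)) 0 = 2 := by decide
    have e1 : (Equiv.swap 0 2 * Equiv.swap 1 3 : Equiv.Perm (Fin 5)) 1 = 3 := by decide
    have e2 : (Equiv.swap 0 2 * Equiv.swap 1 3 : Equiv.Perm (Fin 5)) 2 = 0 := by decide
    have e3 : (Equiv.swap 0 2 * Equiv.swap 1 3 : Equiv.Perm (Fin 5)) 3 = 1 := by decide
    set e : Equiv.Perm (Fin 5) := Equiv.swap 0 2 * Equiv.swap 1 3
    have h1 := mI_sq_le_freqWeight_sq_mul_prod hs hs0 hN hNA (hy 2) (hy 3) y hy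
    have hR : 0 ≤ freqWeight (3 / 4) (3 / 4 + 3 / 2 * s) N (y 2) *
      freqWeight (3 / 4) (3 / 4 + 3 / 2 * s) N (y 3) * ∏ j, mI s N (y j) :=
      (mul_pos (mul_pos (freqWeight_pos hN _) (freqWeight_pos hN _)) hprod).le
    have h2 : √(A ^ 3) * A ≤ 4 * (√K * √|y 0 ^ 2 - y 1 ^ 2|) := by
      rw [← Real.sqrt_mul (by linarith [abs_nonneg (∑ j, y j ^ 3)])]
      refine abs_le_of_sq_le_sq' ?_ (by positivity) |>.2
      have hK0 : 0 ≤ K := (abs_nonneg _).trans hK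
      rw [mul_pow, mul_pow, Real.sq_sqrt (by positivity), Real.sq_sqrt (by positivity)]
      have : A ^ 3 ≤ 4 * K := by linarith
      nlinarith [mul_le_mul this hD (by positivity) (by positivity)]
    have h3 := pairKernel_nonneg (s := s) hN (y ∘ e)
    calc _ ≤ 5 * (mI s N A ^ 2 * A) := hM
      _ ≤ 5 * (√(A ^ 3) * (freqWeight (3 / 4) (3 / 4 + 3 / 2 * s) N (y 2) *
      freqWeight (3 / 4) (3 / 4 + 3 / 2 * s) N (y 3) * ∏ j, mI s N (y j)) * A) := by gcongr
      _ = 5 * ((√(A ^ 3) * A) * (freqWeight (3 / 4) (3 / 4 + 3 / 2 * s) N (y 2) *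
      freqWeight (3 / 4) (3 / 4 + 3 / 2 * s) N (y 3) * ∏ j, mI s N (y j))) := by ring
      _ ≤ 5 * (4 * (√K * √|y 0 ^ 2 - y 1 ^ 2|) *
        (freqWeight (3 / 4) (3 / 4 + 3 / 2 * s) N (y 2) *
      freqWeight (3 / 4) (3 / 4 + 3 / 2 * s) N (y 3) * ∏ j, mI s N (y j))) := by gcongr
      _ = 20 * (∏ j, mI s N (y j)) * (√K * resonanceKernel s N (y ∘ e)) := by
        unfold resonanceKernel
        simp only [Function.comp_apply, e0, e1, e2, e3]; ring
      _ ≤ _ := by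
        have := mul_nonneg (Real.sqrt_nonneg K) (resonanceKernel_nonneg (s := s) hN (y ∘ e))
        gcongr <;> linarith
  by_cases hB1 : A - |y 3| < A / 50
  · obtain ⟨h4, hopp⟩ := exists_opposite_pairs hsum' hA hAdef (hy 1) h12 h23 h34 hB1
    have n3 : 49 / 50 * A < |y 3| := by linarith
    have n2 : 49 / 50 * A < |y 2| := by linarith
    have n1 : 49 / 50 * A < |y 1| := by linarith
    have n0 : 49 / 50 * A < |y 0| := by linarith
    have fin : ∀ (e : Equiv.Perm (Fin 5)), e 4 = 4 → 49 / 50 * A < |y (e 1)| →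
        49 / 50 * A < |y (e 2)| → 49 / 50 * A < |y (e 3)| → y (e 1) * y (e 2) < 0 →
        |y (e 3) + y (e 0)| ≤ |y (e 1) + y (e 2)| → 
        (∑ j, mI s N (y j) ^ 2 * y j) ^ 2 * A ^ 2 ≤
        500 ^ 2 * (|y (e 1) ^ 2 - y (e 2) ^ 2| * |y (e 3) ^ 2 - y (e 4) ^ 2|) * mI s N A ^ 4 := by
      intro e he4 m1 m2 m3 hop hle
      have hse : y (e 1) + y (e 2) + y (e 3) + y (e 0) + y (e 4) = 0 := by
        rw [← hsum, ← Equiv.sum_comp e, Fin.sum_univ_five]; ring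
      have b1 := opposite_pair_bound hA m1 m2 m3 h4 hop
      have b2 := multiplier_sq_le_of_pairs hs' hs0 hN (hy (e 1)) (hy (e 2)) (hy (e 3)) (hy (e 0))
        (hy (e 4)) hse hle
      have b3 : ∑ j, mI s N (y j) ^ 2 * y j = mI s N (y (e 1)) ^ 2 * y (e 1) +
        mI s N (y (e 2)) ^ 2 * y (e 2) + mI s N (y (e 3)) ^ 2 * y (e 3) +
        mI s N (y (e 0)) ^ 2 * y (e 0) + mI s N (y (e 4)) ^ 2 * y (e 4) := by
        rw [← Equiv.sum_comp e, Fin.sum_univ_five]; ring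
      rw [← b3] at b2
      rw [← he4] at b1
      calc _ ≤ 18 * (mI s N A ^ 4 * A * |y (e 1) + y (e 2)|) * A ^ 2 := by gcongr
        _ = 18 * mI s N A ^ 4 * (|y (e 1) + y (e 2)| * A ^ 3) := by ring
        _ ≤ 18 * mI s N A ^ 4 *
            (2 * (|y (e 1) ^ 2 - y (e 2) ^ 2| * |y (e 3) ^ 2 - y (e 4) ^ 2|)) := by
          gcongr
        _ ≤ _ := by
          have : 0 ≤ mI s N A ^ 4 *
              (|y (e 1) ^ 2 - y (e 2) ^ 2| * |y (e 3) ^ 2 - y (e 4) ^ 2|) := by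
            positivity
          nlinarith
    rcases hopp with ⟨o1, o2⟩ | ⟨o1, o2⟩
    · rcases le_total |y 2 + y 3| |y 0 + y 1| with hle | hle
      · exact pair _ (fin ⟨![3, 0, 1, 2, 4], ![1, 2, 3, 0, 4], by decide, by decide⟩ rfl
          n0 n1 n2 o1 hle)
      · exact pair _ (fin ⟨![1, 2, 3, 0, 4], ![3, 0, 1, 2, 4], by decide, by decide⟩ rfl
          n2 n3 n0 o2 hle)
    · rcases le_total |y 1 + y 3| |y 0 + y 2| with hle | hle
      · exact pair _ (fin ⟨![3, 0, 2, 1, 4], ![1, 3, 2, 0, 4], by decide, by decide⟩ rfl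
          n0 n2 n1 o1 hle)
      · exact pair _ (fin ⟨![2, 1, 3, 0, 4], ![3, 1, 0, 2, 4], by decide, by decide⟩ rfl
          n1 n3 n0 o2 hle)
  · refine pair ⟨![2, 0, 3, 1, 4], ![1, 3, 0, 2, 4], by decide, by decide⟩ ?_
    change (∑ j, mI s N (y j) ^ 2 * y j) ^ 2 * A ^ 2 ≤
        500 ^ 2 * (|y 0 ^ 2 - y 3 ^ 2| * |y 1 ^ 2 - y 4 ^ 2|) * mI s N A ^ 4
    push Not at hB1 hB2
    have d3 := two_transversal_pairs hsum' hA hAdef h12 h23 hB1 hB2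
    have hM2 : (∑ j, mI s N (y j) ^ 2 * y j) ^ 2 ≤ (5 * (mI s N A ^ 2 * A)) ^ 2 := by
      rw [← sq_abs]; gcongr
    calc _ ≤ (5 * (mI s N A ^ 2 * A)) ^ 2 * A ^ 2 := by gcongr
      _ = 500 ^ 2 * (A ^ 2 / 50 * (A ^ 2 / 200)) * mI s N A ^ 4 := by ring
      _ ≤ _ := by gcongr

/-- Pointwise bound of the `I`-method multiplier by transversality kernels. -/
lemma multiplier_bound {s N K : ℝ} (hs : -(1 / 6) ≤ s) (hs0 : s ≤ 0) (hN : 0 < N)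
    (x : Fin 5 → ℝ) (hsum : ∑ j, x j = 0) (hK : |∑ j, x j ^ 3| ≤ K) :
    |∑ j, mI s N (x j) ^ 2 * x j| ≤ ∑ e : Equiv.Perm (Fin 5), 500 * (∏ j, mI s N (x j)) *
      (pairKernel s N (x ∘ e) + √K * resonanceKernel s N (x ∘ e)) := by
  have hterm : ∀ e : Equiv.Perm (Fin 5), 0 ≤ 500 * (∏ j, mI s N (x j)) *
      (pairKernel s N (x ∘ e) + √K * resonanceKernel s N (x ∘ e)) := by
    intro e
    have h1 := pairKernel_nonneg (s := s) hN (x ∘ e)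
    have h2 := resonanceKernel_nonneg (s := s) hN (x ∘ e)
    have h3 : 0 ≤ ∏ j, mI s N (x j) := Finset.prod_nonneg fun j _ => (mI_pos hN _).le
    positivity
  set σ : Equiv.Perm (Fin 5) := Tuple.sort (fun j => -|x j|) with hσ
  have hmono := Tuple.monotone_sort (fun j => -|x j|)
  have hanti : ∀ i j : Fin 5, i ≤ j → |x (σ j)| ≤ |x (σ i)| := fun i j hij => by
    have := hmono hij; simpa using this
  by_cases hbig : N < |x (σ 0)|
  · obtain ⟨e, he⟩ := sorted_multiplier_bound (y := x ∘ σ) hs hs0 hN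
      (by simpa [Equiv.sum_comp σ x] using hsum)
      (by
        have := Equiv.sum_comp σ (fun j => x j ^ 3)
        simpa [this] using hK)
      (hanti 0 1 (by decide)) (hanti 1 2 (by decide)) (hanti 2 3 (by decide))
      (hanti 3 4 (by decide)) hbig
    have e1 : ∑ j, mI s N ((x ∘ σ) j) ^ 2 * (x ∘ σ) j = ∑ j, mI s N (x j) ^ 2 * x j :=
      Equiv.sum_comp σ (fun j => mI s N (x j) ^ 2 * x j)
    have e2 : ∏ j, mI s N ((x ∘ σ) j) = ∏ j, mI s N (x j) :=
      Equiv.prod_comp σ (fun j => mI s N (x j))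
    rw [e1, e2, Function.comp_assoc, ← Equiv.Perm.coe_mul] at he
    refine he.trans ?_
    generalize hF : (fun e : Equiv.Perm (Fin 5) => 500 * (∏ j, mI s N (x j)) *
      (pairKernel s N (x ∘ e) + √K * resonanceKernel s N (x ∘ e))) = F
    have hF' : ∀ e : Equiv.Perm (Fin 5), 500 * (∏ j, mI s N (x j)) *
      (pairKernel s N (x ∘ e) + √K * resonanceKernel s N (x ∘ e)) = F e :=
      fun e => congrFun hF e
    simp only [hF'] at hterm ⊢
    exact Finset.single_le_sum (fun e _ => hterm e) (Finset.mem_univ (σ * e))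
  · have h1 : ∀ j, mI s N (x j) = 1 := by
      intro j
      have := hanti 0 (σ.symm j) (Fin.zero_le _)
      rw [Equiv.apply_symm_apply] at this
      unfold mI; rw [if_pos (this.trans (not_lt.1 hbig))]
    have : ∑ j, mI s N (x j) ^ 2 * x j = 0 := by simp [h1, hsum]
    rw [this, abs_zero]
    exact Finset.sum_nonneg fun e _ => hterm e

open scoped ENNReal

/-- The `L²` norm of a nonnegative function on the line. -/
def l2norm (g : ℝ → ℝ≥0∞) : ℝ≥0∞ := (∫⁻ x, g x ^ 2) ^ (1 / 2 : ℝ)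

/-- Square root of the transversality factor `|x² - y²|`. -/
def transv (x y : ℝ) : ℝ≥0∞ := ENNReal.ofReal (√|x ^ 2 - y ^ 2|)

lemma transv_sq (x y : ℝ) : transv x y ^ 2 = ENNReal.ofReal |x ^ 2 - y ^ 2| := by
  unfold transv
  rw [← ENNReal.ofReal_pow (Real.sqrt_nonneg _), Real.sq_sqrt (abs_nonneg _)]

@[fun_prop]
lemma Measurable.transv {α : Type*} [MeasurableSpace α] {f g : α → ℝ} (hf : Measurable f)
    (hg : Measurable g) : Measurable fun a => transv (f a) (g a) := by
  unfold _root_.transv; fun_prop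

lemma ENNReal.rpow_half_sq (a : ℝ≥0∞) : (a ^ (1 / 2 : ℝ)) ^ 2 = a := by
  rw [← ENNReal.rpow_natCast, ← ENNReal.rpow_mul]; norm_num

lemma lintegral_mul_le_sqrt_mul_sqrt {α : Type*} [MeasurableSpace α] {μ : Measure α}
    {f g : α → ℝ≥0∞} (hf : AEMeasurable f μ) (hg : AEMeasurable g μ) :
    ∫⁻ a, f a * g a ∂μ ≤ (∫⁻ a, f a ^ 2 ∂μ) ^ (1 / 2 : ℝ) * (∫⁻ a, g a ^ 2 ∂μ) ^ (1 / 2 : ℝ) := by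
  have := ENNReal.lintegral_mul_le_Lp_mul_Lq μ (p := 2) (q := 2)
    (Real.holderConjugate_iff.2 ⟨by norm_num, by norm_num⟩) hf hg
  simpa only [ENNReal.rpow_two, Pi.mul_apply] using this

lemma lintegral_transv_cubic_le (w : ℝ → ℝ≥0∞) (c d : ℝ) :
    ∫⁻ x, ENNReal.ofReal |x ^ 2 - (c - x) ^ 2| * w (x ^ 3 + (c - x) ^ 3 + d) ≤ 2 * ∫⁻ x, w x := by
  rcases eq_or_ne c 0 with rfl | hc
  · simp
  have hderiv : ∀ x : ℝ, HasDerivAt (fun x : ℝ => x ^ 3 + (c - x) ^ 3 + d)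
      (3 * c * (2 * x - c)) x := by
    intro x
    have h1 := (((hasDerivAt_id x).pow 3).add (((hasDerivAt_id x).const_sub c).pow 3)).add_const d
    refine h1.congr_deriv ?_
    simp only [id]; push_cast; ring
  have key : ∀ s : Set ℝ, MeasurableSet s → (∀ x ∈ s, ∀ y ∈ s, x + y ≠ c) →
      ∫⁻ x in s, ENNReal.ofReal |x ^ 2 - (c - x) ^ 2| * w (x ^ 3 + (c - x) ^ 3 + d)
        ≤ ∫⁻ x, w x := by
    intro s hs hne
    have hinj : Set.InjOn (fun x : ℝ => x ^ 3 + (c - x) ^ 3 + d) s := by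
      intro x hx y hy hxy
      have h1 : 3 * c * ((x - y) * (x + y - c)) = 0 := by
        simp only at hxy; linear_combination hxy
      rcases mul_eq_zero.1 ((mul_eq_zero.1 h1).resolve_left (by simpa)) with h | h
      · linarith
      · exact absurd (by linarith) (hne x hx y hy)
    have := lintegral_image_eq_lintegral_abs_deriv_mul hs
      (fun x _ => (hderiv x).hasDerivWithinAt) hinj w
    calc _ ≤ ∫⁻ x in s, ENNReal.ofReal |3 * c * (2 * x - c)| * w (x ^ 3 + (c - x) ^ 3 + d) := by
          refine lintegral_mono fun x => mul_le_mul_left (ENNReal.ofReal_le_ofReal ?_) _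
          rw [show x ^ 2 - (c - x) ^ 2 = c * (2 * x - c) by ring, mul_assoc, abs_mul 3]
          nlinarith [abs_nonneg (c * (2 * x - c)), abs_of_pos (show (0 : ℝ) < 3 by norm_num)]
      _ = ∫⁻ x in (fun x : ℝ => x ^ 3 + (c - x) ^ 3 + d) '' s, w x := this.symm
      _ ≤ _ := setLIntegral_le_lintegral _ _
  rw [two_mul, ← lintegral_add_compl _ (measurableSet_Iio (a := c / 2)), Set.compl_Iio]
  refine add_le_add (key _ measurableSet_Iio fun x hx y hy => ?_) ?_
  · simp only [Set.mem_Iio] at hx hy; exact (by linarith : x + y < c).ne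
  · rw [setLIntegral_congr Ioi_ae_eq_Ici.symm]
    refine key _ measurableSet_Ioi fun x hx y hy => ?_
    simp only [Set.mem_Ioi] at hx hy; exact (by linarith : c < x + y).ne'

lemma lintegral_three_frequencies_le {w g₁ g₂ g₃ : ℝ → ℝ≥0∞} (hw : Measurable w)
    (h₁ : Measurable g₁) (h₂ : Measurable g₂) (h₃ : Measurable g₃) (S d : ℝ) :
    ∫⁻ x, ∫⁻ y, w (x ^ 3 + y ^ 3 + (-(S + x + y)) ^ 3 + d) * transv x y *
      (g₁ x * g₂ y * g₃ (-(S + x + y))) ≤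
    (2 * ∫⁻ x, w x ^ 2) ^ (1 / 2 : ℝ) * (l2norm g₁ * l2norm g₂ * l2norm g₃) := by
  have hprod := lintegral_prod (μ := (volume : Measure ℝ)) (ν := (volume : Measure ℝ))
    (fun p : ℝ × ℝ => w (p.1 ^ 3 + p.2 ^ 3 + (-(S + p.1 + p.2)) ^ 3 + d) * transv p.1 p.2 *
      (g₁ p.1 * g₂ p.2 * g₃ (-(S + p.1 + p.2)))) (by fun_prop)
  simp only at hprod
  rw [← hprod]
  have hf : Measurable fun p : ℝ × ℝ => g₁ p.1 * g₂ p.2 := by fun_prop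
  have hg : Measurable fun p : ℝ × ℝ =>
      w (p.1 ^ 3 + p.2 ^ 3 + (-(S + p.1 + p.2)) ^ 3 + d) * transv p.1 p.2 *
        g₃ (-(S + p.1 + p.2)) := by fun_prop
  have hcs := lintegral_mul_le_sqrt_mul_sqrt (μ := volume.prod volume)
    hf.aemeasurable hg.aemeasurable
  have e1 : ∫⁻ p : ℝ × ℝ, (g₁ p.1 * g₂ p.2) ^ 2 ∂(volume.prod volume)
      = (∫⁻ x, g₁ x ^ 2) * ∫⁻ x, g₂ x ^ 2 := by
    simp_rw [mul_pow]
    exact lintegral_prod_mul (h₁.pow_const 2).aemeasurable (h₂.pow_const 2).aemeasurable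
  have e2 : ∫⁻ p : ℝ × ℝ, (w (p.1 ^ 3 + p.2 ^ 3 + (-(S + p.1 + p.2)) ^ 3 + d) * transv p.1 p.2 *
      g₃ (-(S + p.1 + p.2))) ^ 2 ∂(volume.prod volume)
      ≤ (2 * ∫⁻ x, w x ^ 2) * ∫⁻ x, g₃ x ^ 2 := by
    rw [lintegral_prod _ (by fun_prop)]
    calc _ = ∫⁻ x, ∫⁻ z, (w (x ^ 3 + (-(S + x) - z) ^ 3 + z ^ 3 + d) * transv x (-(S + x) - z) *
          g₃ z) ^ 2 := by
          congr 1; ext x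
          rw [← lintegral_sub_left_eq_self _ (-(S + x))]
          congr 1; ext z
          simp only
          rw [show -(S + x + (-(S + x) - z)) = z by ring]
      _ = ∫⁻ z, ∫⁻ x, (w (x ^ 3 + (-(S + x) - z) ^ 3 + z ^ 3 + d) * transv x (-(S + x) - z) *
          g₃ z) ^ 2 := lintegral_lintegral_swap (by fun_prop)
      _ = ∫⁻ z, g₃ z ^ 2 * ∫⁻ x, ENNReal.ofReal |x ^ 2 - ((-S - z) - x) ^ 2| *
          w (x ^ 3 + ((-S - z) - x) ^ 3 + (z ^ 3 + d)) ^ 2 := by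
          congr 1; ext z
          rw [← lintegral_const_mul _ (by fun_prop)]
          congr 1; ext x
          rw [mul_pow, mul_pow, transv_sq, show -(S + x) - z = -S - z - x by ring, ← add_assoc]
          ring
      _ ≤ ∫⁻ z, g₃ z ^ 2 * (2 * ∫⁻ x, w x ^ 2) := by
          gcongr with z
          exact lintegral_transv_cubic_le (fun x => w x ^ 2) _ _
      _ = _ := by rw [lintegral_mul_const _ (by fun_prop), mul_comm]
  calc _ = ∫⁻ p : ℝ × ℝ, (g₁ p.1 * g₂ p.2) *
      (w (p.1 ^ 3 + p.2 ^ 3 + (-(S + p.1 + p.2)) ^ 3 + d) * transv p.1 p.2 *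
      g₃ (-(S + p.1 + p.2))) ∂(volume.prod volume) := by
        congr 1; ext p; ring
    _ ≤ _ := hcs
    _ ≤ ((∫⁻ x, g₁ x ^ 2) * ∫⁻ x, g₂ x ^ 2) ^ (1 / 2 : ℝ) *
        ((2 * ∫⁻ x, w x ^ 2) * ∫⁻ x, g₃ x ^ 2) ^ (1 / 2 : ℝ) := by
        rw [e1]; gcongr
    _ = _ := by
        unfold l2norm
        rw [ENNReal.mul_rpow_of_nonneg _ _ (by norm_num),
          ENNReal.mul_rpow_of_nonneg (2 * _) _ (by norm_num)]
        ring

lemma lintegral_four_frequencies_le {w g₁ g₂ g₃ g₄ : ℝ → ℝ≥0∞} (hw : Measurable w)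
    (h₁ : Measurable g₁) (h₂ : Measurable g₂) (h₃ : Measurable g₃) (h₄ : Measurable g₄)
    (S d : ℝ) :
    ∫⁻ x, ∫⁻ y, ∫⁻ z, w (x ^ 3 + y ^ 3 + z ^ 3 + (-(S + x + y + z)) ^ 3 + d) *
      (transv x y * transv z (-(S + x + y + z))) *
      (g₁ x * g₂ y * g₃ z * g₄ (-(S + x + y + z))) ≤
    (2 * ∫⁻ x, w x) * (l2norm g₁ * l2norm g₂ * l2norm g₃ * l2norm g₄) := by
  let μ : Measure (ℝ × ℝ × ℝ) := volume.prod (volume.prod volume)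
  have hprod : ∀ F : ℝ × ℝ × ℝ → ℝ≥0∞, Measurable F →
      ∫⁻ p, F p ∂μ = ∫⁻ x, ∫⁻ y, ∫⁻ z, F (x, y, z) := by
    intro F hF
    rw [lintegral_prod _ hF.aemeasurable]
    congr 1; ext x
    rw [lintegral_prod _ (by fun_prop)]
  rw [← hprod (fun p => w (p.1 ^ 3 + p.2.1 ^ 3 + p.2.2 ^ 3 + (-(S + p.1 + p.2.1 + p.2.2)) ^ 3 + d) *
      (transv p.1 p.2.1 * transv p.2.2 (-(S + p.1 + p.2.1 + p.2.2))) *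
      (g₁ p.1 * g₂ p.2.1 * g₃ p.2.2 * g₄ (-(S + p.1 + p.2.1 + p.2.2)))) (by fun_prop)]
  have hf : Measurable fun p : ℝ × ℝ × ℝ =>
      w (p.1 ^ 3 + p.2.1 ^ 3 + p.2.2 ^ 3 + (-(S + p.1 + p.2.1 + p.2.2)) ^ 3 + d) ^ (1 / 2 : ℝ) *
        transv p.2.2 (-(S + p.1 + p.2.1 + p.2.2)) * (g₁ p.1 * g₂ p.2.1) := by fun_prop
  have hg : Measurable fun p : ℝ × ℝ × ℝ =>
      w (p.1 ^ 3 + p.2.1 ^ 3 + p.2.2 ^ 3 + (-(S + p.1 + p.2.1 + p.2.2)) ^ 3 + d) ^ (1 / 2 : ℝ) *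
        transv p.1 p.2.1 * (g₃ p.2.2 * g₄ (-(S + p.1 + p.2.1 + p.2.2))) := by fun_prop
  have hcs := lintegral_mul_le_sqrt_mul_sqrt (μ := μ) hf.aemeasurable hg.aemeasurable
  simp only [mul_pow, ENNReal.rpow_half_sq, transv_sq] at hcs
  have hconst : ∀ {f g : ℝ → ℝ≥0∞}, Measurable f → Measurable g →
      ∫⁻ x, ∫⁻ y, (f x ^ 2 * g y ^ 2) * (2 * ∫⁻ x, w x) =
        (2 * ∫⁻ x, w x) * ((∫⁻ x, f x ^ 2) * ∫⁻ x, g x ^ 2) := by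
    intro f g hf hg
    have h (x : ℝ) : ∫⁻ y, (f x ^ 2 * g y ^ 2) * (2 * ∫⁻ x, w x) =
        f x ^ 2 * (∫⁻ y, g y ^ 2) * (2 * ∫⁻ x, w x) := by
      rw [lintegral_mul_const _ (by fun_prop), lintegral_const_mul _ (by fun_prop)]
    simp_rw [h]
    rw [lintegral_mul_const _ (by fun_prop), lintegral_mul_const _ (by fun_prop), mul_comm]
  have e1 : ∫⁻ p, w (p.1 ^ 3 + p.2.1 ^ 3 + p.2.2 ^ 3 + (-(S + p.1 + p.2.1 + p.2.2)) ^ 3 + d) *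
      ENNReal.ofReal |p.2.2 ^ 2 - (-(S + p.1 + p.2.1 + p.2.2)) ^ 2| *
      (g₁ p.1 ^ 2 * g₂ p.2.1 ^ 2) ∂μ ≤
      (2 * ∫⁻ x, w x) * ((∫⁻ x, g₁ x ^ 2) * ∫⁻ x, g₂ x ^ 2) := by
    rw [hprod _ (by fun_prop)]
    calc _ = ∫⁻ x, ∫⁻ y, (g₁ x ^ 2 * g₂ y ^ 2) * ∫⁻ z,
          ENNReal.ofReal |z ^ 2 - (-(S + x + y) - z) ^ 2| *
          w (z ^ 3 + (-(S + x + y) - z) ^ 3 + (x ^ 3 + y ^ 3 + d)) := by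
          congr 1; ext x; congr 1; ext y
          rw [← lintegral_const_mul _ (by fun_prop)]
          congr 1; ext z
          simp only
          rw [show -(S + x + y) - z = -(S + x + y + z) by ring,
            show z ^ 3 + (-(S + x + y + z)) ^ 3 + (x ^ 3 + y ^ 3 + d) =
              x ^ 3 + y ^ 3 + z ^ 3 + (-(S + x + y + z)) ^ 3 + d by ring]
          ring
      _ ≤ ∫⁻ x, ∫⁻ y, (g₁ x ^ 2 * g₂ y ^ 2) * (2 * ∫⁻ x, w x) := by
          gcongr with x y
          exact lintegral_transv_cubic_le w _ _
      _ = _ := hconst h₁ h₂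
  have e2 : ∫⁻ p, w (p.1 ^ 3 + p.2.1 ^ 3 + p.2.2 ^ 3 + (-(S + p.1 + p.2.1 + p.2.2)) ^ 3 + d) *
      ENNReal.ofReal |p.1 ^ 2 - p.2.1 ^ 2| *
      (g₃ p.2.2 ^ 2 * g₄ (-(S + p.1 + p.2.1 + p.2.2)) ^ 2) ∂μ ≤
      (2 * ∫⁻ x, w x) * ((∫⁻ x, g₃ x ^ 2) * ∫⁻ x, g₄ x ^ 2) := by
    rw [hprod _ (by fun_prop)]
    simp only
    calc _ = ∫⁻ x, ∫⁻ z, ∫⁻ y, w (x ^ 3 + y ^ 3 + z ^ 3 + (-(S + x + y + z)) ^ 3 + d) *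
          ENNReal.ofReal |x ^ 2 - y ^ 2| * (g₃ z ^ 2 * g₄ (-(S + x + y + z)) ^ 2) := by
          congr 1; ext x
          exact lintegral_lintegral_swap (by fun_prop)
      _ = ∫⁻ z, ∫⁻ x, ∫⁻ y, w (x ^ 3 + y ^ 3 + z ^ 3 + (-(S + x + y + z)) ^ 3 + d) *
          ENNReal.ofReal |x ^ 2 - y ^ 2| * (g₃ z ^ 2 * g₄ (-(S + x + y + z)) ^ 2) :=
          lintegral_lintegral_swap (Measurable.lintegral_prod_right (by fun_prop)).aemeasurable
      _ = ∫⁻ z, ∫⁻ x, ∫⁻ t, w (x ^ 3 + (-(S + x + z) - t) ^ 3 + z ^ 3 + t ^ 3 + d) *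
          ENNReal.ofReal |x ^ 2 - (-(S + x + z) - t) ^ 2| * (g₃ z ^ 2 * g₄ t ^ 2) := by
          congr 1; ext z; congr 1; ext x
          rw [← lintegral_sub_left_eq_self _ (-(S + x + z))]
          congr 1; ext t
          rw [show -(S + x + (-(S + x + z) - t) + z) = t by ring]
      _ = ∫⁻ z, ∫⁻ t, ∫⁻ x, w (x ^ 3 + (-(S + x + z) - t) ^ 3 + z ^ 3 + t ^ 3 + d) *
          ENNReal.ofReal |x ^ 2 - (-(S + x + z) - t) ^ 2| * (g₃ z ^ 2 * g₄ t ^ 2) := by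
          congr 1; ext z
          exact lintegral_lintegral_swap (by fun_prop)
      _ = ∫⁻ z, ∫⁻ t, (g₃ z ^ 2 * g₄ t ^ 2) * ∫⁻ x,
          ENNReal.ofReal |x ^ 2 - (-(S + z + t) - x) ^ 2| *
          w (x ^ 3 + (-(S + z + t) - x) ^ 3 + (z ^ 3 + t ^ 3 + d)) := by
          congr 1; ext z; congr 1; ext t
          rw [← lintegral_const_mul _ (by fun_prop)]
          congr 1; ext x
          rw [show -(S + x + z) - t = -(S + z + t) - x by ring,
            show x ^ 3 + (-(S + z + t) - x) ^ 3 + (z ^ 3 + t ^ 3 + d) =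
              x ^ 3 + (-(S + z + t) - x) ^ 3 + z ^ 3 + t ^ 3 + d by ring]
          ring
      _ ≤ ∫⁻ z, ∫⁻ t, (g₃ z ^ 2 * g₄ t ^ 2) * (2 * ∫⁻ x, w x) := by
          gcongr with z t
          exact lintegral_transv_cubic_le w _ _
      _ = _ := hconst h₃ h₄
  calc _ = ∫⁻ p, w (p.1 ^ 3 + p.2.1 ^ 3 + p.2.2 ^ 3 + (-(S + p.1 + p.2.1 + p.2.2)) ^ 3 + d)
          ^ (1 / 2 : ℝ) * transv p.2.2 (-(S + p.1 + p.2.1 + p.2.2)) * (g₁ p.1 * g₂ p.2.1) *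
        (w (p.1 ^ 3 + p.2.1 ^ 3 + p.2.2 ^ 3 + (-(S + p.1 + p.2.1 + p.2.2)) ^ 3 + d)
          ^ (1 / 2 : ℝ) * transv p.1 p.2.1 * (g₃ p.2.2 * g₄ (-(S + p.1 + p.2.1 + p.2.2)))) ∂μ := by
        congr 1; ext p
        conv_lhs => rw [← ENNReal.rpow_half_sq (w _)]
        ring
    _ ≤ _ := hcs
    _ ≤ ((2 * ∫⁻ x, w x) * ((∫⁻ x, g₁ x ^ 2) * ∫⁻ x, g₂ x ^ 2)) ^ (1 / 2 : ℝ) *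
        ((2 * ∫⁻ x, w x) * ((∫⁻ x, g₃ x ^ 2) * ∫⁻ x, g₄ x ^ 2)) ^ (1 / 2 : ℝ) := by
        gcongr
    _ = _ := by
        unfold l2norm
        simp only [ENNReal.mul_rpow_of_nonneg _ _ (show (0 : ℝ) ≤ 1 / 2 by norm_num)]
        conv_rhs => rw [← ENNReal.rpow_half_sq (∫⁻ x, w x), ← ENNReal.rpow_half_sq 2]
        ring

@[fun_prop]
lemma Measurable.fin_cons {α : Type*} [MeasurableSpace α] {n : ℕ} {f : α → ℝ}
    {g : α → Fin n → ℝ} (hf : Measurable f) (hg : Measurable g) :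
    Measurable fun a => (Fin.cons (f a) (g a) : Fin (n + 1) → ℝ) := by
  refine measurable_pi_lambda _ fun j => ?_
  refine Fin.cases ?_ (fun k => ?_) j
  · simpa using hf
  · simp only [Fin.cons_succ]; fun_prop

lemma lintegral_fin_succ {n : ℕ} {F : (Fin (n + 1) → ℝ) → ℝ≥0∞} (hF : Measurable F) :
    ∫⁻ v, F v = ∫⁻ x, ∫⁻ v : Fin n → ℝ, F (Fin.cons x v) := by
  have h := (volume_preserving_piFinSuccAbove (fun _ : Fin (n + 1) => ℝ) 0).symm
  rw [← h.lintegral_comp hF]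
  change ∫⁻ p, _ ∂(volume.prod volume) = _
  rw [lintegral_prod _ (by fun_prop)]
  simp [MeasurableEquiv.piFinSuccAbove, Fin.insertNthEquiv]

lemma lintegral_fin_zero (F : (Fin 0 → ℝ) → ℝ≥0∞) : ∫⁻ v, F v = F ![] := by
  rw [lintegral_unique, volume_pi, Measure.pi_univ]
  simp only [Finset.univ_eq_empty, Finset.prod_empty, mul_one]
  exact congrArg F (Subsingleton.elim _ _)

lemma lintegral_fin_four {F : (Fin 4 → ℝ) → ℝ≥0∞} (hF : Measurable F) :
    ∫⁻ v, F v = ∫⁻ a, ∫⁻ x, ∫⁻ y, ∫⁻ z, F ![a, x, y, z] := by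
  rw [lintegral_fin_succ hF]
  congr 1; ext a
  rw [lintegral_fin_succ (by fun_prop)]
  congr 1; ext x
  rw [lintegral_fin_succ (by fun_prop)]
  congr 1; ext y
  rw [lintegral_fin_succ (by fun_prop)]
  congr 1; ext z
  rw [lintegral_fin_zero]
  rfl

lemma lintegral_fin_prod (n : ℕ) {f : Fin n → ℝ → ℝ≥0∞} (hf : ∀ j, Measurable (f j)) :
    ∫⁻ v : Fin n → ℝ, ∏ j, f j (v j) = ∏ j, ∫⁻ x, f j x := by
  induction n with
  | zero => rw [lintegral_fin_zero]; simp
  | succ n ih =>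
    rw [lintegral_fin_succ (by fun_prop), Fin.prod_univ_succ, ← ih fun j => hf j.succ]
    simp_rw [Fin.prod_univ_succ, Fin.cons_zero, Fin.cons_succ]
    have h (x : ℝ) : ∫⁻ v : Fin n → ℝ, f 0 x * ∏ j : Fin n, f j.succ (v j) =
        f 0 x * ∫⁻ v : Fin n → ℝ, ∏ j : Fin n, f j.succ (v j) :=
      lintegral_const_mul _ (by fun_prop)
    simp_rw [h]
    rw [lintegral_mul_const _ (hf 0)]

@[fun_prop]
lemma measurable_padZero (n : ℕ) : Measurable (padZero n) := by
  refine measurable_pi_lambda _ fun j => ?_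
  unfold padZero
  split_ifs <;> fun_prop

lemma padZero_castSucc {n : ℕ} (v : Fin n → ℝ) (i : Fin n) :
    padZero (n + 1) v i.castSucc = v i := by
  simp [padZero]

lemma padZero_last {n : ℕ} (v : Fin n → ℝ) : padZero (n + 1) v (Fin.last n) = -∑ i, v i := by
  simp [padZero]

lemma sum_padZero {n : ℕ} (v : Fin n → ℝ) : ∑ j, padZero (n + 1) v j = 0 := by
  rw [Fin.sum_univ_castSucc]
  simp [padZero_castSucc, padZero_last]

lemma padZero_add {n : ℕ} (v w : Fin n → ℝ) (j : Fin (n + 1)) :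
    padZero (n + 1) (v + w) j = padZero (n + 1) v j + padZero (n + 1) w j := by
  refine Fin.lastCases ?_ (fun k => ?_) j <;>
    simp [padZero_castSucc, padZero_last, Finset.sum_add_distrib, add_comm]

lemma padZero_smul {n : ℕ} (c : ℝ) (v : Fin n → ℝ) (j : Fin (n + 1)) :
    padZero (n + 1) (c • v) j = c * padZero (n + 1) v j := by
  refine Fin.lastCases ?_ (fun k => ?_) j <;>
    simp [padZero_castSucc, padZero_last, Finset.mul_sum]

/-- The action of a permutation of `n + 1` frequencies summing to zero on the first `n` of them. -/
def permZeroSum {n : ℕ} (e : Equiv.Perm (Fin (n + 1))) : (Fin n → ℝ) →ₗ[ℝ] (Fin n → ℝ) where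
  toFun v i := padZero (n + 1) v (e i.castSucc)
  map_add' v w := funext fun i => padZero_add v w (e i.castSucc)
  map_smul' c v := funext fun i => padZero_smul c v (e i.castSucc)

lemma padZero_permZeroSum {n : ℕ} (e : Equiv.Perm (Fin (n + 1))) (v : Fin n → ℝ) :
    padZero (n + 1) (permZeroSum e v) = padZero (n + 1) v ∘ e := by
  ext j
  refine Fin.lastCases ?_ (fun k => ?_) j
  · have h := sum_padZero v
    rw [← Equiv.sum_comp e, Fin.sum_univ_castSucc] at h
    rw [padZero_last]
    simp only [permZeroSum, LinearMap.coe_mk, AddHom.coe_mk, Function.comp_apply]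
    linarith
  · rw [padZero_castSucc]; rfl

lemma permZeroSum_pow {n : ℕ} (e : Equiv.Perm (Fin (n + 1))) (k : ℕ) :
    permZeroSum e ^ k = permZeroSum (e ^ k) := by
  induction k with
  | zero =>
    ext v i
    simp [permZeroSum, padZero_castSucc]
  | succ k ih =>
    rw [pow_succ', pow_succ, ih]
    refine LinearMap.ext fun v => funext fun i => ?_
    change padZero (n + 1) (permZeroSum (e ^ k) v) (e i.castSucc) = _
    rw [padZero_permZeroSum]
    rfl

lemma measurePreserving_permZeroSum {n : ℕ} (e : Equiv.Perm (Fin (n + 1))) :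
    MeasurePreserving (permZeroSum e) := by
  have hdet : |LinearMap.det (permZeroSum e)| = 1 := by
    refine (pow_eq_one_iff_of_nonneg (abs_nonneg _) (orderOf_pos e).ne').1 ?_
    rw [← abs_pow, ← map_pow, permZeroSum_pow, pow_orderOf_eq_one,
      ← pow_zero e, ← permZeroSum_pow, pow_zero, map_one, abs_one]
  refine ⟨(permZeroSum e).continuous_of_finiteDimensional.measurable, ?_⟩
  rw [Real.map_linearMap_volume_pi_eq_smul_volume_pi (fun h => by simp [h] at hdet), abs_inv, hdet]
  simp

lemma lintegral_padZero_comp_perm {n : ℕ} (e : Equiv.Perm (Fin (n + 1)))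
    {F : (Fin (n + 1) → ℝ) → ℝ≥0∞} (hF : Measurable F) :
    ∫⁻ v : Fin n → ℝ, F (padZero (n + 1) v ∘ e) = ∫⁻ v : Fin n → ℝ, F (padZero (n + 1) v) := by
  simp_rw [← padZero_permZeroSum]
  exact (measurePreserving_permZeroSum e).lintegral_comp (hF.comp (measurable_padZero (n + 1)))

lemma padZero_vec (a x y z : ℝ) :
    padZero 5 ![a, x, y, z] = ![a, x, y, z, -(a + x + y + z)] := by
  ext j
  fin_cases j <;> simp [padZero, Fin.sum_univ_four]

lemma lintegral_pair_form_le {w W : ℝ → ℝ≥0∞} {g : Fin 5 → ℝ → ℝ≥0∞} (hw : Measurable w)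
    (hW : Measurable W) (hg : ∀ j, Measurable (g j)) :
    ∫⁻ v : Fin 4 → ℝ, w (∑ j, padZero 5 v j ^ 3) *
      (transv (padZero 5 v 1) (padZero 5 v 2) * transv (padZero 5 v 3) (padZero 5 v 4) *
        W (padZero 5 v 0)) * ∏ j, g j (padZero 5 v j) ≤
      l2norm W * (2 * ∫⁻ x, w x) * ∏ j, l2norm (g j) := by
  have hpad (j : Fin 5) : Measurable fun v : Fin 4 → ℝ => padZero 5 v j :=
    (measurable_pi_apply j).comp (measurable_padZero 5)
  rw [lintegral_fin_four (by fun_prop)]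
  simp only [padZero_vec, Fin.sum_univ_five, Fin.prod_univ_five]
  simp only [Matrix.cons_val]
  calc _ = ∫⁻ a, (W a * g 0 a) * ∫⁻ x, ∫⁻ y, ∫⁻ z,
        w (x ^ 3 + y ^ 3 + z ^ 3 + (-(a + x + y + z)) ^ 3 + a ^ 3) *
          (transv x y * transv z (-(a + x + y + z))) *
          (g 1 x * g 2 y * g 3 z * g 4 (-(a + x + y + z))) := by
        congr 1; ext a
        rw [← lintegral_const_mul _ (by fun_prop)]
        congr 1; ext x
        rw [← lintegral_const_mul _ (by fun_prop)]
        congr 1; ext y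
        rw [← lintegral_const_mul _ (by fun_prop)]
        congr 1; ext z
        rw [show a ^ 3 + x ^ 3 + y ^ 3 + z ^ 3 + (-(a + x + y + z)) ^ 3 =
          x ^ 3 + y ^ 3 + z ^ 3 + (-(a + x + y + z)) ^ 3 + a ^ 3 by ring]
        ring
    _ ≤ ∫⁻ a, (W a * g 0 a) * ((2 * ∫⁻ x, w x) *
        (l2norm (g 1) * l2norm (g 2) * l2norm (g 3) * l2norm (g 4))) := by
        gcongr with a
        exact lintegral_four_frequencies_le hw (hg 1) (hg 2) (hg 3) (hg 4) a (a ^ 3)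
    _ = (∫⁻ a, W a * g 0 a) * ((2 * ∫⁻ x, w x) *
        (l2norm (g 1) * l2norm (g 2) * l2norm (g 3) * l2norm (g 4))) :=
        lintegral_mul_const _ (by fun_prop)
    _ ≤ (l2norm W * l2norm (g 0)) * ((2 * ∫⁻ x, w x) *
        (l2norm (g 1) * l2norm (g 2) * l2norm (g 3) * l2norm (g 4))) := by
        gcongr
        exact lintegral_mul_le_sqrt_mul_sqrt hW.aemeasurable (hg 0).aemeasurable
    _ = _ := by ring

lemma lintegral_resonance_form_le {w V : ℝ → ℝ≥0∞} {g : Fin 5 → ℝ → ℝ≥0∞} (hw : Measurable w)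
    (hV : Measurable V) (hg : ∀ j, Measurable (g j)) :
    ∫⁻ v : Fin 4 → ℝ, w (∑ j, padZero 5 v j ^ 3) *
      (transv (padZero 5 v 2) (padZero 5 v 3) * V (padZero 5 v 0) * V (padZero 5 v 1)) *
        ∏ j, g j (padZero 5 v j) ≤
      l2norm V ^ 2 * (2 * ∫⁻ x, w x ^ 2) ^ (1 / 2 : ℝ) * ∏ j, l2norm (g j) := by
  have hpad (j : Fin 5) : Measurable fun v : Fin 4 → ℝ => padZero 5 v j :=
    (measurable_pi_apply j).comp (measurable_padZero 5)
  rw [lintegral_fin_four (by fun_prop)]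
  simp only [padZero_vec, Fin.sum_univ_five, Fin.prod_univ_five]
  simp only [Matrix.cons_val]
  set D := (2 * ∫⁻ x, w x ^ 2) ^ (1 / 2 : ℝ) * (l2norm (g 2) * l2norm (g 3) * l2norm (g 4)) with hD
  calc _ = ∫⁻ a, (V a * g 0 a) * ∫⁻ x, (V x * g 1 x) * ∫⁻ y, ∫⁻ z,
        w (y ^ 3 + z ^ 3 + (-(a + x + y + z)) ^ 3 + (a ^ 3 + x ^ 3)) * transv y z *
          (g 2 y * g 3 z * g 4 (-(a + x + y + z))) := by
        congr 1; ext a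
        rw [← lintegral_const_mul _ (by fun_prop)]
        congr 1; ext x
        rw [← mul_assoc, ← lintegral_const_mul _ (by fun_prop)]
        congr 1; ext y
        rw [← lintegral_const_mul _ (by fun_prop)]
        congr 1; ext z
        rw [show a ^ 3 + x ^ 3 + y ^ 3 + z ^ 3 + (-(a + x + y + z)) ^ 3 =
          y ^ 3 + z ^ 3 + (-(a + x + y + z)) ^ 3 + (a ^ 3 + x ^ 3) by ring]
        ring
    _ ≤ ∫⁻ a, (V a * g 0 a) * ∫⁻ x, (V x * g 1 x) * D := by
        gcongr with a x
        exact lintegral_three_frequencies_le hw (hg 2) (hg 3) (hg 4) (a + x) (a ^ 3 + x ^ 3)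
    _ = (∫⁻ a, V a * g 0 a) * ((∫⁻ x, V x * g 1 x) * D) := by
        rw [lintegral_mul_const D (f := fun x => V x * g 1 x) (by fun_prop)]
        exact lintegral_mul_const _ (by fun_prop)
    _ ≤ (l2norm V * l2norm (g 0)) * ((l2norm V * l2norm (g 1)) * D) := by
        gcongr
        · exact lintegral_mul_le_sqrt_mul_sqrt hV.aemeasurable (hg 0).aemeasurable
        · exact lintegral_mul_le_sqrt_mul_sqrt hV.aemeasurable (hg 1).aemeasurable
    _ = _ := by rw [hD]; ring

/-- The frequency weights `freqWeight`, valued in the extended nonnegative reals. -/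
def eFreqWeight (p r N ξ : ℝ) : ℝ≥0∞ := ENNReal.ofReal (freqWeight p r N ξ)

@[fun_prop]
lemma measurable_eFreqWeight (p r N : ℝ) : Measurable (eFreqWeight p r N) := by
  unfold eFreqWeight freqWeight freqRatio; fun_prop

lemma ofReal_pairKernel (s N : ℝ) (y : Fin 5 → ℝ) :
    ENNReal.ofReal (pairKernel s N y) =
      transv (y 1) (y 2) * transv (y 3) (y 4) * eFreqWeight 1 (1 + 3 * s) N (y 0) := by
  unfold pairKernel transv eFreqWeight
  rw [ENNReal.ofReal_mul (by positivity), ENNReal.ofReal_mul (by positivity)]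

lemma ofReal_resonanceKernel {s N : ℝ} (hN : 0 < N) (y : Fin 5 → ℝ) :
    ENNReal.ofReal (resonanceKernel s N y) =
      transv (y 2) (y 3) * eFreqWeight (3 / 4) (3 / 4 + 3 / 2 * s) N (y 0) *
        eFreqWeight (3 / 4) (3 / 4 + 3 / 2 * s) N (y 1) := by
  have h (ξ : ℝ) := (freqWeight_pos (p := 3 / 4) (r := 3 / 4 + 3 / 2 * s) hN ξ).le
  unfold resonanceKernel transv eFreqWeight
  rw [ENNReal.ofReal_mul (mul_nonneg (Real.sqrt_nonneg _) (h _)),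
    ENNReal.ofReal_mul (Real.sqrt_nonneg _)]

lemma measurable_mI (s N : ℝ) : Measurable (mI s N) := by
  unfold mI
  exact Measurable.ite (measurableSet_le (by fun_prop) (by fun_prop)) (by fun_prop) (by fun_prop)

/-- The constant in the estimate of the multiplier form with modulation weight `w`. -/
def formConst (s N K : ℝ) (w : ℝ → ℝ≥0∞) : ℝ≥0∞ :=
  l2norm (eFreqWeight 1 (1 + 3 * s) N) * (2 * ∫⁻ x, w x) +
    ENNReal.ofReal √K * (l2norm (eFreqWeight (3 / 4) (3 / 4 + 3 / 2 * s) N) ^ 2 *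
      (2 * ∫⁻ x, w x ^ 2) ^ (1 / 2 : ℝ))

lemma lintegral_multiplier_form_le {s N K : ℝ} (hs : -(1 / 6) ≤ s) (hs0 : s ≤ 0) (hN : 0 < N)
    {w : ℝ → ℝ≥0∞} (hw : Measurable w) (hwK : ∀ x, K < |x| → w x = 0)
    {h : Fin 5 → ℝ → ℝ≥0∞} (hh : ∀ j, Measurable (h j)) :
    ∫⁻ v : Fin 4 → ℝ, w (∑ j, padZero 5 v j ^ 3) *
      ENNReal.ofReal |∑ j, mI s N (padZero 5 v j) ^ 2 * padZero 5 v j| *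
        ∏ j, h j (padZero 5 v j) ≤
      60000 * formConst s N K w *
        ∏ j, l2norm fun ξ => ENNReal.ofReal (mI s N ξ) * h j ξ := by
  have hm := measurable_mI s N
  set W := eFreqWeight 1 (1 + 3 * s) N
  set V := eFreqWeight (3 / 4) (3 / 4 + 3 / 2 * s) N
  have hW : Measurable W := measurable_eFreqWeight _ _ _
  have hV : Measurable V := measurable_eFreqWeight _ _ _
  set g : Fin 5 → ℝ → ℝ≥0∞ := fun j ξ => ENNReal.ofReal (mI s N ξ) * h j ξ with hg
  have hgm : ∀ j, Measurable (g j) := fun j => by simp only [hg]; fun_prop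
  have hpad (j : Fin 5) : Measurable fun v : Fin 4 → ℝ => padZero 5 v j :=
    (measurable_pi_apply j).comp (measurable_padZero 5)
  let A (e : Equiv.Perm (Fin 5)) (y : Fin 5 → ℝ) : ℝ≥0∞ := w (∑ j, y j ^ 3) *
    (transv (y 1) (y 2) * transv (y 3) (y 4) * W (y 0)) * ∏ j, g (e j) (y j)
  let B (e : Equiv.Perm (Fin 5)) (y : Fin 5 → ℝ) : ℝ≥0∞ := w (∑ j, y j ^ 3) *
    (transv (y 2) (y 3) * V (y 0) * V (y 1)) * ∏ j, g (e j) (y j)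
  have hA (e) : Measurable (A e) := by fun_prop
  have hB (e) : Measurable (B e) := by fun_prop
  have hpoint (v : Fin 4 → ℝ) : w (∑ j, padZero 5 v j ^ 3) *
      ENNReal.ofReal |∑ j, mI s N (padZero 5 v j) ^ 2 * padZero 5 v j| *
        ∏ j, h j (padZero 5 v j) ≤ ∑ e : Equiv.Perm (Fin 5),
        500 * (A e (padZero 5 v ∘ e) + ENNReal.ofReal √K * B e (padZero 5 v ∘ e)) := by
    set x := padZero 5 v
    rcases lt_or_ge K |∑ j, x j ^ 3| with hK | hK
    · simp [hwK _ hK]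
    have hkernel (e : Equiv.Perm (Fin 5)) :
        ENNReal.ofReal (500 * (∏ j, mI s N (x j)) *
          (pairKernel s N (x ∘ e) + √K * resonanceKernel s N (x ∘ e))) =
        500 * (∏ j, ENNReal.ofReal (mI s N (x j))) *
          (transv (x (e 1)) (x (e 2)) * transv (x (e 3)) (x (e 4)) * W (x (e 0)) +
            ENNReal.ofReal √K * (transv (x (e 2)) (x (e 3)) * V (x (e 0)) * V (x (e 1)))) := by
      have hmp : 0 ≤ ∏ j, mI s N (x j) := Finset.prod_nonneg fun j _ => (mI_pos hN _).le
      rw [ENNReal.ofReal_mul (by positivity), ENNReal.ofReal_mul (by positivity),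
        ENNReal.ofReal_prod_of_nonneg fun j _ => (mI_pos hN _).le,
        ENNReal.ofReal_add (pairKernel_nonneg hN _)
          (mul_nonneg (Real.sqrt_nonneg _) (resonanceKernel_nonneg hN _)),
        ENNReal.ofReal_mul (Real.sqrt_nonneg _), ofReal_pairKernel s N, ofReal_resonanceKernel hN]
      simp only [Function.comp_apply, W, V]
      norm_num
    calc _ ≤ w (∑ j, x j ^ 3) * ENNReal.ofReal (∑ e : Equiv.Perm (Fin 5),
          500 * (∏ j, mI s N (x j)) *
            (pairKernel s N (x ∘ e) + √K * resonanceKernel s N (x ∘ e))) * ∏ j, h j (x j) := by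
          gcongr
          exact multiplier_bound hs hs0 hN x (sum_padZero (n := 4) v) hK
      _ = _ := by
          rw [ENNReal.ofReal_sum_of_nonneg fun e _ => mul_nonneg
            (mul_nonneg (by norm_num) (Finset.prod_nonneg fun j _ => (mI_pos hN _).le))
            (add_nonneg (pairKernel_nonneg hN _)
              (mul_nonneg (Real.sqrt_nonneg _) (resonanceKernel_nonneg hN _))),
            Finset.mul_sum, Finset.sum_mul]
          refine Finset.sum_congr rfl fun e _ => ?_
          rw [hkernel]
          simp only [A, B, Function.comp_apply]
          rw [Equiv.sum_comp e fun j => x j ^ 3, Equiv.prod_comp e fun j => g j (x j)]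
          simp only [hg, Finset.prod_mul_distrib]
          ring
  calc _ ≤ ∫⁻ v : Fin 4 → ℝ, ∑ e : Equiv.Perm (Fin 5),
        500 * (A e (padZero 5 v ∘ e) + ENNReal.ofReal √K * B e (padZero 5 v ∘ e)) :=
        lintegral_mono hpoint
    _ = ∑ e : Equiv.Perm (Fin 5), 500 * ((∫⁻ v : Fin 4 → ℝ, A e (padZero 5 v)) +
        ENNReal.ofReal √K * ∫⁻ v : Fin 4 → ℝ, B e (padZero 5 v)) := by
        have hp (e : Equiv.Perm (Fin 5)) : Measurable fun v : Fin 4 → ℝ => padZero 5 v ∘ e :=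
          measurable_pi_lambda _ fun j => hpad (e j)
        rw [lintegral_finsetSum _ fun e _ => by
          have := (hA e).comp (hp e)
          have := (hB e).comp (hp e)
          simp only [Function.comp_def] at *
          fun_prop]
        refine Finset.sum_congr rfl fun e _ => ?_
        have hAe : Measurable fun v : Fin 4 → ℝ => A e (padZero 5 v ∘ e) := (hA e).comp (hp e)
        have hBe : Measurable fun v : Fin 4 → ℝ => B e (padZero 5 v ∘ e) := (hB e).comp (hp e)
        rw [lintegral_const_mul _ (by fun_prop), lintegral_add_left hAe, lintegral_const_mul _ hBe,
          ← lintegral_padZero_comp_perm (n := 4) e (hA e),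
          ← lintegral_padZero_comp_perm (n := 4) e (hB e)]
    _ ≤ ∑ e : Equiv.Perm (Fin 5), 500 * (l2norm W * (2 * ∫⁻ x, w x) * (∏ j, l2norm (g j)) +
        ENNReal.ofReal √K * (l2norm V ^ 2 * (2 * ∫⁻ x, w x ^ 2) ^ (1 / 2 : ℝ) *
          ∏ j, l2norm (g j))) := by
        gcongr with e
        · rw [← Equiv.prod_comp e]
          exact lintegral_pair_form_le hw hW fun j => hgm (e j)
        · rw [← Equiv.prod_comp e]
          exact lintegral_resonance_form_le hw hV fun j => hgm (e j)
    _ = _ := by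
        rw [Finset.sum_const, Finset.card_univ, Fintype.card_perm, Fintype.card_fin, nsmul_eq_mul]
        simp only [formConst, show Nat.factorial 5 = 120 by decide]
        push_cast
        ring

lemma lintegral_comp_mul {N : ℝ} (hN : 0 < N) {f : ℝ → ℝ≥0∞} (hf : Measurable f) :
    ∫⁻ x, f x = ENNReal.ofReal N * ∫⁻ y, f (N * y) := by
  have h : ∫⁻ y, f (N * y) = ENNReal.ofReal N⁻¹ * ∫⁻ x, f x := by
    rw [← lintegral_map hf (by fun_prop : Measurable fun y : ℝ => N * y),
      Real.map_volume_mul_left hN.ne', lintegral_smul_measure, abs_of_pos (inv_pos.2 hN),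
      smul_eq_mul]
  rw [h, ← mul_assoc, ← ENNReal.ofReal_mul hN.le, mul_inv_cancel₀ hN.ne',
    ENNReal.ofReal_one, one_mul]

lemma lintegral_freqRatio_lt_top {r : ℝ} (hr : 1 < r) :
    ∫⁻ y, ENNReal.ofReal (freqRatio 1 y ^ (-r)) < ⊤ := by
  have h := finite_integral_one_add_norm (E := ℝ) (μ := volume) (r := r) (by simpa using hr)
  calc ∫⁻ y, ENNReal.ofReal (freqRatio 1 y ^ (-r))
      ≤ ∫⁻ y : ℝ, ENNReal.ofReal (2 ^ r) * ENNReal.ofReal ((1 + ‖y‖) ^ (-r)) := by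
        refine lintegral_mono fun y => ?_
        rw [← ENNReal.ofReal_mul (by positivity)]
        refine ENNReal.ofReal_le_ofReal ?_
        rw [show (2 : ℝ) ^ r * (1 + ‖y‖) ^ (-r) = ((1 + ‖y‖) / 2) ^ (-r) by
          rw [Real.div_rpow (by positivity) (by norm_num), Real.rpow_neg (by norm_num : (0:ℝ) ≤ 2),
            div_inv_eq_mul, mul_comm]]
        refine Real.rpow_le_rpow_of_nonpos (by positivity) ?_ (by linarith)
        have h1 : 1 ≤ freqRatio 1 y := le_max_left _ _
        have h2 : |y| ≤ freqRatio 1 y := (div_one |y|).ge.trans (le_max_right _ _)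
        rw [Real.norm_eq_abs]; linarith
    _ = ENNReal.ofReal (2 ^ r) * ∫⁻ y : ℝ, ENNReal.ofReal ((1 + ‖y‖) ^ (-r)) :=
        lintegral_const_mul _ (by fun_prop)
    _ < ⊤ := ENNReal.mul_lt_top ENNReal.ofReal_lt_top h

lemma exists_l2norm_eFreqWeight_le {p r : ℝ} (hr : 1 < 2 * r) :
    ∃ C : ℝ≥0∞, C ≠ ⊤ ∧ ∀ N : ℝ, 0 < N →
      l2norm (eFreqWeight p r N) = C * ENNReal.ofReal (N ^ (1 / 2 - p)) := by
  refine ⟨(∫⁻ y, ENNReal.ofReal (freqRatio 1 y ^ (-(2 * r)))) ^ (1 / 2 : ℝ),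
    ENNReal.rpow_ne_top_of_nonneg (by norm_num) (lintegral_freqRatio_lt_top hr).ne, fun N hN => ?_⟩
  have h1 (y : ℝ) : eFreqWeight p r N (N * y) ^ 2 =
      ENNReal.ofReal (N ^ (-(2 * p))) * ENNReal.ofReal (freqRatio 1 y ^ (-(2 * r))) := by
    have h2 : freqRatio N (N * y) = freqRatio 1 y := by
      unfold freqRatio
      rw [abs_mul, abs_of_pos hN, mul_div_cancel_left₀ _ hN.ne', div_one]
    unfold eFreqWeight freqWeight
    rw [h2, ← ENNReal.ofReal_pow (mul_nonneg (by positivity)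
      (Real.rpow_nonneg (freqRatio_pos 1 y).le _)), ← ENNReal.ofReal_mul (by positivity), mul_pow,
      ← Real.rpow_mul_natCast hN.le, ← Real.rpow_mul_natCast (freqRatio_pos 1 y).le]
    congr 3 <;> push_cast <;> ring_nf
  have hmeas : Measurable fun y => ENNReal.ofReal (freqRatio 1 y ^ (-(2 * r))) := by
    unfold freqRatio; fun_prop
  unfold l2norm
  rw [lintegral_comp_mul hN (by fun_prop)]
  simp_rw [h1]
  rw [lintegral_const_mul _ hmeas, ← mul_assoc, ENNReal.mul_rpow_of_nonneg _ _ (by norm_num),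
    mul_comm, ← ENNReal.ofReal_mul hN.le,
    ENNReal.ofReal_rpow_of_nonneg (by positivity) (by norm_num)]
  congr 2
  rw [Real.mul_rpow hN.le (by positivity), ← Real.rpow_mul hN.le, ← Real.rpow_add hN]
  congr 1; ring

/-- The decay in the modulation gained by integrating over a bounded time interval. -/
def timeWeight (a x : ℝ) : ℝ≥0∞ := ENNReal.ofReal ((1 + |x|) ^ (-a))

@[fun_prop]
lemma measurable_timeWeight (a : ℝ) : Measurable (timeWeight a) := by
  unfold timeWeight; fun_prop

lemma timeWeight_sq (a x : ℝ) : timeWeight a x ^ 2 = timeWeight (2 * a) x := by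
  unfold timeWeight
  rw [← ENNReal.ofReal_pow (by positivity), ← Real.rpow_mul_natCast (by positivity)]
  congr 2; push_cast; ring

lemma setLIntegral_timeWeight_Icc_le {a K : ℝ} (ha1 : a < 1) (ha : 0 ≤ a) (hK : 0 < K) :
    ∫⁻ x in Set.Icc 0 K, timeWeight a x ≤ ENNReal.ofReal (K ^ (1 - a) / (1 - a)) := by
  have hcont : ContinuousOn (fun x : ℝ => (1 + |x|) ^ (-a)) (Set.Icc 0 K) := by
    refine ContinuousOn.rpow_const (by fun_prop) fun x _ => Or.inl (by positivity)
  unfold timeWeight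
  rw [← ofReal_integral_eq_lintegral_ofReal hcont.integrableOn_Icc
    (ae_of_all _ fun x => by positivity)]
  refine ENNReal.ofReal_le_ofReal ?_
  rw [integral_Icc_eq_integral_Ioc, ← intervalIntegral.integral_of_le hK.le]
  have h : ∫ x in (0 : ℝ)..K, (1 + |x|) ^ (-a) = ∫ x in (0 : ℝ)..K, (1 + x) ^ (-a) := by
    refine intervalIntegral.integral_congr fun x hx => ?_
    rw [Set.uIcc_of_le hK.le] at hx
    simp only [abs_of_nonneg hx.1]
  rw [h, intervalIntegral.integral_comp_add_left (fun x => x ^ (-a)),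
    integral_rpow (Or.inl (by linarith))]
  rw [show -a + 1 = 1 - a by ring, add_zero, Real.one_rpow]
  have := Real.rpow_add_le_add_rpow (zero_le_one) hK.le (by linarith : 0 ≤ 1 - a) (by linarith)
  rw [Real.one_rpow] at this
  exact div_le_div_of_nonneg_right (by linarith) (by linarith)

lemma exists_setLIntegral_timeWeight_le {a : ℝ} (ha : 0 ≤ a) (ha1 : a < 1) :
    ∃ C : ℝ, 0 < C ∧ ∀ K l : ℝ, 0 < K →
      ∫⁻ x in Set.Ioo (-K) K, timeWeight a (x + l) ≤ ENNReal.ofReal (C * K ^ (1 - a)) := by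
  have ha1' : 0 < 1 - a := by linarith
  refine ⟨2 / (1 - a) + 2, by positivity, fun K l hK => ?_⟩
  have hsplit (x : ℝ) : timeWeight a (x + l) ≤
      (Set.Ioo (-K) K).indicator (timeWeight a) (x + l) + ENNReal.ofReal (K ^ (-a)) := by
    by_cases hx : x + l ∈ Set.Ioo (-K) K
    · simp [hx]
    · rw [Set.indicator_of_notMem hx, zero_add]
      refine ENNReal.ofReal_le_ofReal (Real.rpow_le_rpow_of_nonpos hK ?_ (by linarith))
      have : K ≤ |x + l| := by
        by_contra h
        exact hx (abs_lt.1 (not_le.1 h))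
      linarith
  have hneg : ∫⁻ x in Set.Icc (-K) 0, timeWeight a x = ∫⁻ x in Set.Icc 0 K, timeWeight a x := by
    rw [← (Measure.measurePreserving_neg (volume : Measure ℝ)).setLIntegral_comp_preimage
      measurableSet_Icc (measurable_timeWeight a)]
    simp [timeWeight]
  have hsym : ∫⁻ x in Set.Ioo (-K) K, timeWeight a x ≤
      ENNReal.ofReal (K ^ (1 - a) / (1 - a)) + ENNReal.ofReal (K ^ (1 - a) / (1 - a)) := by
    calc _ ≤ ∫⁻ x in Set.Icc (-K) 0 ∪ Set.Icc 0 K, timeWeight a x := by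
          refine lintegral_mono_set fun x hx => ?_
          rcases le_total x 0 with h | h
          · exact Or.inl ⟨hx.1.le, h⟩
          · exact Or.inr ⟨h, hx.2.le⟩
      _ ≤ (∫⁻ x in Set.Icc (-K) 0, timeWeight a x) + ∫⁻ x in Set.Icc 0 K, timeWeight a x :=
          lintegral_union_le _ _ _
      _ ≤ _ := by
          rw [hneg]
          gcongr <;> exact setLIntegral_timeWeight_Icc_le ha1 ha hK
  calc _ ≤ ∫⁻ x in Set.Ioo (-K) K, ((Set.Ioo (-K) K).indicator (timeWeight a) (x + l) +
        ENNReal.ofReal (K ^ (-a))) := lintegral_mono hsplit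
    _ = (∫⁻ x in Set.Ioo (-K) K, (Set.Ioo (-K) K).indicator (timeWeight a) (x + l)) +
        ENNReal.ofReal (K ^ (-a)) * ENNReal.ofReal (2 * K) := by
        rw [lintegral_add_right _ measurable_const, setLIntegral_const, Real.volume_Ioo]
        congr 3; ring
    _ ≤ (∫⁻ x, (Set.Ioo (-K) K).indicator (timeWeight a) (x + l)) +
        ENNReal.ofReal (K ^ (-a)) * ENNReal.ofReal (2 * K) := by
        exact add_le_add_left (setLIntegral_le_lintegral _ _) _
    _ = (∫⁻ x in Set.Ioo (-K) K, timeWeight a x) +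
        ENNReal.ofReal (K ^ (-a)) * ENNReal.ofReal (2 * K) := by
        rw [lintegral_add_right_eq_self (fun x => (Set.Ioo (-K) K).indicator (timeWeight a) x),
          lintegral_indicator measurableSet_Ioo]
    _ ≤ (ENNReal.ofReal (K ^ (1 - a) / (1 - a)) + ENNReal.ofReal (K ^ (1 - a) / (1 - a))) +
        ENNReal.ofReal (K ^ (-a)) * ENNReal.ofReal (2 * K) := by gcongr
    _ = _ := by
        rw [← ENNReal.ofReal_mul (by positivity), ← ENNReal.ofReal_add (by positivity)
          (by positivity), ← ENNReal.ofReal_add (by positivity) (by positivity)]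
        rw [show K ^ (1 - a) = K ^ (-a) * K by
          rw [← Real.rpow_add_one hK.ne']; congr 1; ring]
        congr 1; field_simp; ring

/-- The modulation weight: the resonance function is cut off at `K` and shifted by `l`. -/
def modWeight (ε K l : ℝ) : ℝ → ℝ≥0∞ :=
  (Set.Ioo (-K) K).indicator fun x => 3 * timeWeight ε (x + l)

@[fun_prop]
lemma measurable_modWeight (ε K l : ℝ) : Measurable (modWeight ε K l) :=
  Measurable.indicator (by fun_prop) measurableSet_Ioo

lemma exists_formConst_le {s ε : ℝ} (hs : -(1 / 6) < s) (hε : 0 ≤ ε) (hε1 : 2 * ε < 1) :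
    ∃ C : ℝ, 0 < C ∧ ∀ N K l : ℝ, 0 < N → 0 < K → formConst s N K (modWeight ε K l) ≤
      ENNReal.ofReal (C * N ^ (-(1 / 2) : ℝ) * K ^ (1 - ε)) := by
  obtain ⟨CW, hCW, hW⟩ := exists_l2norm_eFreqWeight_le (p := 1) (r := 1 + 3 * s) (by linarith)
  obtain ⟨CV, hCV, hV⟩ := exists_l2norm_eFreqWeight_le (p := 3 / 4) (r := 3 / 4 + 3 / 2 * s)
    (by linarith)
  obtain ⟨C1, hC1, h1⟩ := exists_setLIntegral_timeWeight_le hε (by linarith)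
  obtain ⟨C2, hC2, h2⟩ := exists_setLIntegral_timeWeight_le (a := 2 * ε) (by linarith) hε1
  lift CW to NNReal using hCW
  lift CV to NNReal using hCV
  refine ⟨CW * (6 * C1) + CV ^ 2 * √(18 * C2) + 1, by positivity, fun N K l hN hK => ?_⟩
  have hi1 : ∫⁻ x, modWeight ε K l x ≤ ENNReal.ofReal (3 * (C1 * K ^ (1 - ε))) := by
    unfold modWeight
    rw [lintegral_indicator measurableSet_Ioo, lintegral_const_mul _ (by fun_prop),
      ENNReal.ofReal_mul (by norm_num), ENNReal.ofReal_ofNat]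
    gcongr
    exact h1 K l hK
  have hi2 : ∫⁻ x, modWeight ε K l x ^ 2 ≤ ENNReal.ofReal (9 * (C2 * K ^ (1 - 2 * ε))) := by
    have h (x : ℝ) : modWeight ε K l x ^ 2 =
        (Set.Ioo (-K) K).indicator (fun x => 9 * timeWeight (2 * ε) (x + l)) x := by
      unfold modWeight
      by_cases hx : x ∈ Set.Ioo (-K) K
      · rw [Set.indicator_of_mem hx, Set.indicator_of_mem hx, mul_pow, timeWeight_sq]; norm_num
      · rw [Set.indicator_of_notMem hx, Set.indicator_of_notMem hx]; simp
    simp_rw [h]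
    rw [lintegral_indicator measurableSet_Ioo, lintegral_const_mul _ (by fun_prop),
      ENNReal.ofReal_mul (by norm_num), ENNReal.ofReal_ofNat]
    gcongr
    exact h2 K l hK
  unfold formConst
  rw [hW N hN, hV N hN]
  calc _ ≤ ↑CW * ENNReal.ofReal (N ^ (1 / 2 - 1 : ℝ)) *
          (2 * ENNReal.ofReal (3 * (C1 * K ^ (1 - ε)))) +
        ENNReal.ofReal √K * ((↑CV * ENNReal.ofReal (N ^ (1 / 2 - 3 / 4 : ℝ))) ^ 2 *
          (2 * ENNReal.ofReal (9 * (C2 * K ^ (1 - 2 * ε)))) ^ (1 / 2 : ℝ)) := by gcongr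
    _ = ENNReal.ofReal (CW * N ^ (1 / 2 - 1 : ℝ) * (2 * (3 * (C1 * K ^ (1 - ε)))) +
        √K * ((CV * N ^ (1 / 2 - 3 / 4 : ℝ)) ^ 2 *
          (2 * (9 * (C2 * K ^ (1 - 2 * ε)))) ^ (1 / 2 : ℝ))) := by
        rw [← ENNReal.ofReal_coe_nnreal, ← ENNReal.ofReal_coe_nnreal (p := CV),
          ← ENNReal.ofReal_ofNat 2, ← ENNReal.ofReal_mul (by positivity),
          ← ENNReal.ofReal_mul (by positivity), ← ENNReal.ofReal_mul (by positivity),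
          ← ENNReal.ofReal_mul (by positivity), ← ENNReal.ofReal_mul (by positivity),
          ← ENNReal.ofReal_pow (by positivity),
          ENNReal.ofReal_rpow_of_nonneg (by positivity) (by norm_num),
          ← ENNReal.ofReal_mul (by positivity), ← ENNReal.ofReal_mul (by positivity),
          ← ENNReal.ofReal_add (by positivity) (by positivity)]
    _ ≤ _ := by
        refine ENNReal.ofReal_le_ofReal ?_
        have e1 : (N ^ (1 / 2 - 3 / 4 : ℝ)) ^ 2 = N ^ (-(1 / 2) : ℝ) := by
          rw [← Real.rpow_mul_natCast hN.le]; norm_num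
        have e2 : (2 * (9 * (C2 * K ^ (1 - 2 * ε)))) ^ (1 / 2 : ℝ) =
            √(18 * C2) * K ^ (1 / 2 - ε) := by
          rw [show 2 * (9 * (C2 * K ^ (1 - 2 * ε))) = 18 * C2 * K ^ (1 - 2 * ε) by ring,
            Real.mul_rpow (by positivity) (by positivity), ← Real.sqrt_eq_rpow,
            ← Real.rpow_mul hK.le]
          congr 2; ring
        have e3 : K ^ (1 - ε) = √K * K ^ (1 / 2 - ε) := by
          rw [Real.sqrt_eq_rpow, ← Real.rpow_add hK]; congr 1; ring
        rw [mul_pow, e1, e2, show (1 / 2 - 1 : ℝ) = -(1 / 2) by norm_num]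
        have : 0 ≤ N ^ (-(1 / 2) : ℝ) * K ^ (1 - ε) := by positivity
        rw [e3] at this ⊢
        nlinarith

open scoped FourierTransform in
lemma exists_schwartzMap_eq_FT2 (u : SchwartzMap (ℝ × ℝ) ℂ) :
    ∃ G : SchwartzMap (ℝ × ℝ) ℂ, ∀ q, G q = FT2 u q.1 q.2 := by
  let L : WithLp 2 (ℝ × ℝ) ≃L[ℝ] ℝ × ℝ := WithLp.prodContinuousLinearEquiv 2 ℝ ℝ ℝ
  let D : (ℝ × ℝ) ≃L[ℝ] WithLp 2 (ℝ × ℝ) := (ContinuousLinearEquiv.smulLeft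
    (Units.mk0 (2 * Real.pi)⁻¹ (by positivity))).trans L.symm
  refine ⟨SchwartzMap.compCLMOfContinuousLinearEquiv ℂ D
    (𝓕 (SchwartzMap.compCLMOfContinuousLinearEquiv ℂ L u)), fun q => ?_⟩
  rw [SchwartzMap.compCLMOfContinuousLinearEquiv_apply, Function.comp_apply,
    SchwartzMap.fourier_coe, Real.fourier_eq', FT2]
  rw [← (WithLp.volume_preserving_ofLp ℝ ℝ).integral_comp
    (MeasurableEquiv.toLp 2 (ℝ × ℝ)).symm.measurableEmbedding]
  congr 1; ext p
  rw [SchwartzMap.compCLMOfContinuousLinearEquiv_apply, smul_eq_mul, WithLp.prod_inner_apply]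
  have h1 : (D q).ofLp.1 = (2 * Real.pi)⁻¹ * q.1 := rfl
  have h2 : (D q).ofLp.2 = (2 * Real.pi)⁻¹ * q.2 := rfl
  rw [h1, h2]
  have hpi := Real.pi_ne_zero
  congr 2
  simp only [Real.inner_apply]
  rw [← mul_neg, mul_comm]
  congr 1
  rw [← Complex.ofReal_neg, Complex.ofReal_inj]
  field_simp

lemma SchwartzMap.exists_norm_le (G : SchwartzMap (ℝ × ℝ) ℂ) (k : ℕ) :
    ∃ C : ℝ, 0 ≤ C ∧ ∀ q, (1 + ‖q‖) ^ k * ‖G q‖ ≤ C := by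
  have h (q : ℝ × ℝ) :=
    SchwartzMap.one_add_le_sup_seminorm_apply (𝕜 := ℂ) (m := (k, 0)) le_rfl le_rfl G q
  simp only [norm_iteratedFDeriv_zero] at h
  exact ⟨_, le_trans (by positivity) (h 0), h⟩

lemma SchwartzMap.exists_norm_slice_le (G : SchwartzMap (ℝ × ℝ) ℂ) :
    ∃ C : ℝ, ∀ x y : ℝ, ‖G (x, y)‖ ≤ C * (1 + ‖x‖) ^ (-2 : ℝ) ∧
      ‖G (x, y)‖ ≤ C * (1 + ‖y‖) ^ (-2 : ℝ) := by
  obtain ⟨C, hC, h⟩ := G.exists_norm_le 2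
  have key : ∀ (q : ℝ × ℝ) (z : ℝ), ‖z‖ ≤ ‖q‖ → ‖G q‖ ≤ C * (1 + ‖z‖) ^ (-2 : ℝ) := by
    intro q z hz
    rw [Real.rpow_neg (by positivity), Real.rpow_two, ← div_eq_mul_inv, le_div_iff₀ (by positivity)]
    refine le_trans ?_ (h q)
    rw [mul_comm]
    gcongr
  exact ⟨C, fun x y => ⟨key (x, y) x (norm_fst_le (x, y)), key (x, y) y (norm_snd_le (x, y))⟩⟩

lemma SchwartzMap.integrable_slice_left (G : SchwartzMap (ℝ × ℝ) ℂ) (y : ℝ) :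
    Integrable fun x => G (x, y) := by
  obtain ⟨C, h⟩ := G.exists_norm_slice_le
  refine ((integrable_one_add_norm (E := ℝ) (r := 2) (by simp)).const_mul C).mono'
    (G.continuous.comp (by fun_prop)).aestronglyMeasurable (ae_of_all _ fun x => (h x y).1)

lemma norm_exp_neg_I_mul (x : ℝ) : ‖Complex.exp (-(Complex.I * (x : ℂ)))‖ = 1 := by
  rw [show -(Complex.I * (x : ℂ)) = ((-x : ℝ) : ℂ) * Complex.I by push_cast; ring]
  exact Complex.norm_exp_ofReal_mul_I _

lemma continuous_FTs_slice (u : SchwartzMap (ℝ × ℝ) ℂ) (ξ : ℝ) :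
    Continuous fun t => FTs (fun x => u (t, x)) ξ := by
  obtain ⟨C, h⟩ := u.exists_norm_slice_le
  have hu := u.continuous
  refine continuous_of_dominated (bound := fun x => C * (1 + ‖x‖) ^ (-2 : ℝ)) (fun t => ?_)
    (fun t => ae_of_all _ fun x => ?_) ((integrable_one_add_norm (by simp)).const_mul C)
    (ae_of_all _ fun x => by fun_prop)
  · exact Continuous.aestronglyMeasurable (by fun_prop)
  · rw [norm_mul, norm_exp_neg_I_mul, one_mul]
    exact (h t x).2

lemma integrable_exp_mul (u : SchwartzMap (ℝ × ℝ) ℂ) (τ ξ : ℝ) :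
    Integrable (fun p : ℝ × ℝ =>
      Complex.exp (-(Complex.I * ((p.1 * τ + p.2 * ξ : ℝ) : ℂ))) * u p) (volume.prod volume) := by
  have hu : Integrable u (volume.prod volume) := u.integrable (μ := volume)
  refine hu.bdd_mul (c := 1) (Continuous.aestronglyMeasurable (by fun_prop))
    (ae_of_all _ fun p => (norm_exp_neg_I_mul _).le)

lemma FT2_eq_integral_FTs (u : SchwartzMap (ℝ × ℝ) ℂ) (τ ξ : ℝ) :
    FT2 u τ ξ = ∫ t : ℝ, Complex.exp (-(Complex.I * ((t * τ : ℝ) : ℂ))) *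
      FTs (fun x => u (t, x)) ξ := by
  unfold FT2 FTs
  change ∫ p, _ ∂(volume.prod volume) = _
  rw [integral_prod _ (integrable_exp_mul u τ ξ)]
  congr 1; ext t
  rw [← integral_const_mul]
  congr 1; ext x
  rw [← mul_assoc, ← Complex.exp_add]
  congr 2; push_cast; ring

lemma integrable_FTs_slice (u : SchwartzMap (ℝ × ℝ) ℂ) (ξ : ℝ) :
    Integrable fun t => FTs (fun x => u (t, x)) ξ := by
  have h := (integrable_exp_mul u 0 ξ).integral_prod_left
  simpa [FTs] using h

open scoped FourierTransform in
lemma FTs_slice_eq (u : SchwartzMap (ℝ × ℝ) ℂ) (σ ξ : ℝ) :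
    FTs (fun x => u (σ, x)) ξ = (2 * Real.pi : ℝ)⁻¹ * ∫ l : ℝ,
      Complex.exp (Complex.I * ((σ * (ξ ^ 3 + l) : ℝ) : ℂ)) * FT2 u (ξ ^ 3 + l) ξ := by
  obtain ⟨G, hG⟩ := exists_schwartzMap_eq_FT2 u
  set f : ℝ → ℂ := fun t => FTs (fun x => u (t, x)) ξ with hf
  have hpi := Real.pi_pos
  have hF (y : ℝ) : 𝓕 f y = G (2 * Real.pi * y, ξ) := by
    rw [hG, FT2_eq_integral_FTs, Real.fourier_real_eq_integral_exp_smul]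
    congr 1; ext t
    rw [smul_eq_mul]
    congr 2; push_cast; ring
  have hFi : Integrable (𝓕 f) := by
    rw [show 𝓕 f = fun y => G (2 * Real.pi * y, ξ) from funext hF]
    exact (G.integrable_slice_left ξ).comp_mul_left' (by positivity)
  have h := congrFun ((continuous_FTs_slice u ξ).fourierInv_fourier_eq
    (integrable_FTs_slice u ξ) hFi) σ
  rw [← h, Real.fourierInv_eq']
  have h1 := Measure.integral_comp_mul_left (fun τ : ℝ =>
    Complex.exp (Complex.I * ((σ * τ : ℝ) : ℂ)) * FT2 u τ ξ) (2 * Real.pi)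
  rw [abs_of_pos (by positivity)] at h1
  rw [integral_add_left_eq_self (fun τ : ℝ =>
    Complex.exp (Complex.I * ((σ * τ : ℝ) : ℂ)) * FT2 u τ ξ), ← Complex.real_smul, ← h1]
  congr 1; ext y
  rw [hF, hG, smul_eq_mul]
  congr 2
  simp only [Real.inner_apply]
  push_cast; ring

lemma norm_integral_exp_mul_le {t : ℝ} (ht : 0 < t) (ht1 : t ≤ 1) (θ : ℝ) :
    ‖∫ σ in (0 : ℝ)..t, Complex.exp (Complex.I * ((σ * θ : ℝ) : ℂ))‖ * (1 + |θ|) ≤ 3 := by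
  have hexp (x : ℝ) : ‖Complex.exp (Complex.I * (x : ℂ))‖ = 1 := by
    rw [mul_comm]; exact Complex.norm_exp_ofReal_mul_I x
  have h1 : ‖∫ σ in (0 : ℝ)..t, Complex.exp (Complex.I * ((σ * θ : ℝ) : ℂ))‖ ≤ 1 := by
    refine (intervalIntegral.norm_integral_le_of_norm_le_const (C := 1) fun σ _ =>
      (hexp _).le).trans ?_
    rw [sub_zero, abs_of_pos ht, one_mul]; exact ht1
  have h2 : ‖∫ σ in (0 : ℝ)..t, Complex.exp (Complex.I * ((σ * θ : ℝ) : ℂ))‖ * |θ| ≤ 2 := by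
    rcases eq_or_ne θ 0 with rfl | hθ
    · simp
    have hc : Complex.I * (θ : ℂ) ≠ 0 := by simp [hθ]
    have h3 := integral_exp_mul_complex (a := 0) (b := t) hc
    have h4 : ∫ σ in (0 : ℝ)..t, Complex.exp (Complex.I * ((σ * θ : ℝ) : ℂ)) =
        ∫ σ in (0 : ℝ)..t, Complex.exp (Complex.I * (θ : ℂ) * (σ : ℂ)) := by
      congr 1; ext σ; congr 1; push_cast; ring
    rw [h4, h3, norm_div, norm_mul, Complex.norm_I, one_mul, Complex.norm_real, Real.norm_eq_abs,
      div_mul_cancel₀ _ (abs_ne_zero.2 hθ)]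
    refine (norm_sub_le _ _).trans ?_
    have h5 := hexp (θ * t)
    have h6 := hexp (θ * 0)
    push_cast at h5 h6
    rw [mul_assoc, mul_assoc, h5]
    simp only [Complex.ofReal_zero, h6]
    norm_num
  linarith

lemma enorm_integral_exp_mul_le {t ε : ℝ} (ht : 0 < t) (ht1 : t ≤ 1) (hε1 : ε ≤ 1) (θ : ℝ) :
    ‖∫ σ in (0 : ℝ)..t, Complex.exp (Complex.I * ((σ * θ : ℝ) : ℂ))‖ₑ ≤ 3 * timeWeight ε θ := by
  rw [← ofReal_norm, timeWeight, ← ENNReal.ofReal_ofNat 3, ← ENNReal.ofReal_mul (by norm_num)]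
  refine ENNReal.ofReal_le_ofReal ?_
  have h := norm_integral_exp_mul_le ht ht1 θ
  rw [← le_div_iff₀ (by positivity)] at h
  refine h.trans ?_
  rw [div_eq_mul_inv, ← Real.rpow_neg_one]
  gcongr
  exact le_add_of_nonneg_right (abs_nonneg θ)

lemma enorm_integral_integral_exp_mul_le {Z : Type*} [MeasurableSpace Z] {μ : Measure Z}
    [SFinite μ] {H : Z → ℂ} (hH : Integrable H μ) {θ : Z → ℝ} (hθ : Measurable θ)
    {t ε : ℝ} (ht : 0 < t) (ht1 : t ≤ 1) (hε1 : ε ≤ 1) :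
    ‖∫ σ in (0 : ℝ)..t, ∫ z, Complex.exp (Complex.I * ((σ * θ z : ℝ) : ℂ)) * H z ∂μ‖ₑ ≤
      ∫⁻ z, 3 * timeWeight ε (θ z) * ‖H z‖ₑ ∂μ := by
  have hInt : Integrable (Function.uncurry fun (σ : ℝ) z =>
      Complex.exp (Complex.I * ((σ * θ z : ℝ) : ℂ)) * H z)
      ((volume.restrict (Set.Ioc 0 t)).prod μ) := by
    refine (hH.comp_snd (volume.restrict (Set.Ioc 0 t))).bdd_mul (c := 1)
      (Measurable.aestronglyMeasurable (by fun_prop)) (ae_of_all _ fun p => ?_)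
    rw [mul_comm]; exact (Complex.norm_exp_ofReal_mul_I _).le
  rw [intervalIntegral.integral_of_le ht.le, integral_integral_swap hInt]
  refine (enorm_integral_le_lintegral_enorm _).trans (lintegral_mono fun z => ?_)
  rw [integral_mul_const, enorm_mul, ← intervalIntegral.integral_of_le ht.le]
  gcongr
  exact enorm_integral_exp_mul_le ht ht1 hε1 (θ z)

/-- The `L²` norm in frequency of `m · g` along the translate by `l` of the cubic. -/
def cubicSliceNorm (s N : ℝ) (g : ℝ × ℝ → ℝ≥0∞) (l : ℝ) : ℝ≥0∞ :=
  l2norm fun ξ => ENNReal.ofReal (mI s N ξ) * g (ξ ^ 3 + l, ξ)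

lemma measurable_cubicSliceNorm (s N : ℝ) {g : ℝ × ℝ → ℝ≥0∞} (hg : Measurable g) :
    Measurable (cubicSliceNorm s N g) := by
  have := measurable_mI s N
  unfold cubicSliceNorm l2norm
  refine Measurable.pow_const (Measurable.lintegral_prod_right' (f := fun p : ℝ × ℝ =>
    (ENNReal.ofReal (mI s N p.2) * g (p.2 ^ 3 + p.1, p.2)) ^ 2) ?_) _
  fun_prop

lemma lintegral_resonant_form_le {s N K ε C : ℝ} (hs : -(1 / 6) ≤ s) (hs0 : s ≤ 0) (hN : 0 < N)
    (hC : ∀ l : ℝ, formConst s N K (modWeight ε K l) ≤ ENNReal.ofReal C)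
    {g : ℝ × ℝ → ℝ≥0∞} (hg : Measurable g) :
    ∫⁻ l : Fin 5 → ℝ, ∫⁻ v : Fin 4 → ℝ, modWeight ε K (∑ j, l j) (∑ j, padZero 5 v j ^ 3) *
      ENNReal.ofReal |∑ j, mI s N (padZero 5 v j) ^ 2 * padZero 5 v j| *
        ∏ j, g (padZero 5 v j ^ 3 + l j, padZero 5 v j) ≤
      60000 * ENNReal.ofReal C * (∫⁻ l, cubicSliceNorm s N g l) ^ 5 := by
  have hm := measurable_cubicSliceNorm s N hg
  calc _ ≤ ∫⁻ l : Fin 5 → ℝ, 60000 * ENNReal.ofReal C * ∏ j, cubicSliceNorm s N g (l j) := by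
        refine lintegral_mono fun l => ?_
        refine (lintegral_multiplier_form_le hs hs0 hN (K := K)
          (measurable_modWeight ε K (∑ j, l j)) (fun x hx => ?_)
          (h := fun j ξ => g (ξ ^ 3 + l j, ξ)) (fun j => by fun_prop)).trans ?_
        · have hx' : x ∉ Set.Ioo (-K) K := fun h => (abs_lt.2 h).not_gt hx
          exact Set.indicator_of_notMem hx' _
        · exact mul_le_mul_left (α := ℝ≥0∞) (mul_le_mul_right (α := ℝ≥0∞) (hC _) _) _
    _ = _ := by
        rw [lintegral_const_mul _ (by fun_prop), lintegral_fin_prod 5 (fun _ => hm),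
          Finset.prod_const, Finset.card_univ, Fintype.card_fin]

lemma l2norm_sq (f : ℝ → ℝ≥0∞) : l2norm f ^ 2 = ∫⁻ x, f x ^ 2 :=
  ENNReal.rpow_half_sq _

lemma lintegral_mul_cubicSliceNorm_sq (s : ℝ) {N : ℝ} (hN : 0 < N)
    {g : ℝ × ℝ → ℝ≥0∞} (hg : Measurable g) {w : ℝ → ℝ≥0∞} (hw : Measurable w) :
    ∫⁻ l, w l * cubicSliceNorm s N g l ^ 2 =
      ∫⁻ q : ℝ × ℝ, ENNReal.ofReal (mI s N q.2 ^ 2) * w (q.1 - q.2 ^ 3) * g q ^ 2 := by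
  have hm := measurable_mI s N
  unfold cubicSliceNorm
  simp_rw [l2norm_sq]
  calc _ = ∫⁻ l, ∫⁻ ξ, w l * (ENNReal.ofReal (mI s N ξ) * g (ξ ^ 3 + l, ξ)) ^ 2 := by
        refine lintegral_congr fun l => (lintegral_const_mul _ (by fun_prop)).symm
    _ = ∫⁻ ξ, ∫⁻ l, w l * (ENNReal.ofReal (mI s N ξ) * g (ξ ^ 3 + l, ξ)) ^ 2 :=
        lintegral_lintegral_swap (Measurable.aemeasurable (by fun_prop))
    _ = ∫⁻ ξ, ∫⁻ τ, ENNReal.ofReal (mI s N ξ ^ 2) * w (τ - ξ ^ 3) * g (τ, ξ) ^ 2 := by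
        refine lintegral_congr fun ξ => ?_
        rw [← lintegral_add_left_eq_self (fun τ => ENNReal.ofReal (mI s N ξ ^ 2) * w (τ - ξ ^ 3) *
          g (τ, ξ) ^ 2) (ξ ^ 3)]
        refine lintegral_congr fun l => ?_
        rw [add_sub_cancel_left, mul_pow, ENNReal.ofReal_pow (mI_pos hN ξ).le]
        ring
    _ = _ := by
        change _ = ∫⁻ q, _ ∂(volume.prod volume)
        rw [lintegral_prod_symm' _ (by fun_prop)]

lemma exists_lintegral_cubicSliceNorm_le {b : ℝ} (hb : 1 / 2 < b) :
    ∃ C : ℝ, 0 < C ∧ ∀ (s N : ℝ) (g : ℝ × ℝ → ℝ≥0∞), 0 < N → Measurable g →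
      ∫⁻ l, cubicSliceNorm s N g l ≤ ENNReal.ofReal C *
        (∫⁻ q : ℝ × ℝ, ENNReal.ofReal (mI s N q.2 ^ 2 * (1 + (q.1 - q.2 ^ 3) ^ 2) ^ b) *
          g q ^ 2) ^ (1 / 2 : ℝ) := by
  have hfin : ∫⁻ l : ℝ, ENNReal.ofReal ((1 + l ^ 2) ^ (-b)) < ⊤ := by
    have h := (integrable_rpow_neg_one_add_norm_sq (E := ℝ) (μ := volume) (r := 2 * b)
      (by simp; linarith)).lintegral_lt_top
    refine lt_of_eq_of_lt (lintegral_congr fun l => ?_) h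
    rw [Real.norm_eq_abs, sq_abs]
    congr 2; ring
  refine ⟨((∫⁻ l : ℝ, ENNReal.ofReal ((1 + l ^ 2) ^ (-b))) ^ (1 / 2 : ℝ)).toReal + 1,
    by positivity, fun s N g hN hg => ?_⟩
  have hm := measurable_cubicSliceNorm s N hg
  have hpos (l : ℝ) : 0 < 1 + l ^ 2 := by positivity
  calc ∫⁻ l, cubicSliceNorm s N g l
      = ∫⁻ l, ENNReal.ofReal ((1 + l ^ 2) ^ (-(b / 2))) *
          (ENNReal.ofReal ((1 + l ^ 2) ^ (b / 2)) * cubicSliceNorm s N g l) := by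
        refine lintegral_congr fun l => ?_
        rw [← mul_assoc, ← ENNReal.ofReal_mul (Real.rpow_nonneg (hpos l).le _),
          ← Real.rpow_add (hpos l), neg_add_cancel, Real.rpow_zero, ENNReal.ofReal_one, one_mul]
    _ ≤ (∫⁻ l, ENNReal.ofReal ((1 + l ^ 2) ^ (-(b / 2))) ^ 2) ^ (1 / 2 : ℝ) *
        (∫⁻ l, (ENNReal.ofReal ((1 + l ^ 2) ^ (b / 2)) * cubicSliceNorm s N g l) ^ 2) ^
          (1 / 2 : ℝ) :=
        lintegral_mul_le_sqrt_mul_sqrt (Measurable.aemeasurable (by fun_prop))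
          (Measurable.aemeasurable (by fun_prop))
    _ = (∫⁻ l : ℝ, ENNReal.ofReal ((1 + l ^ 2) ^ (-b))) ^ (1 / 2 : ℝ) *
        (∫⁻ q : ℝ × ℝ, ENNReal.ofReal (mI s N q.2 ^ 2 * (1 + (q.1 - q.2 ^ 3) ^ 2) ^ b) *
          g q ^ 2) ^ (1 / 2 : ℝ) := by
        have hsq (c l : ℝ) : ENNReal.ofReal ((1 + l ^ 2) ^ (c / 2)) ^ 2 =
            ENNReal.ofReal ((1 + l ^ 2) ^ c) := by
          rw [← ENNReal.ofReal_pow (Real.rpow_nonneg (hpos l).le _),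
            ← Real.rpow_mul_natCast (hpos l).le]
          congr 2; push_cast; ring
        simp_rw [mul_pow, ← neg_div, hsq]
        rw [lintegral_mul_cubicSliceNorm_sq s hN hg
          (w := fun l => ENNReal.ofReal ((1 + l ^ 2) ^ b)) (by fun_prop)]
        simp_rw [ENNReal.ofReal_mul (sq_nonneg (mI s N _))]
    _ ≤ _ := by
        gcongr
        refine ENNReal.le_ofReal_iff_toReal_le ?_ (by positivity) |>.2 (by linarith)
        exact ENNReal.rpow_ne_top_of_nonneg (by norm_num) hfin.ne

lemma lintegral_eq_XnormI_sq {s N b : ℝ} (hs : s ≤ 0) (hN : 0 < N) (hb : b ≤ 1)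
    (u : SchwartzMap (ℝ × ℝ) ℂ) :
    ∫⁻ q : ℝ × ℝ, ENNReal.ofReal (mI s N q.2 ^ 2 * (1 + (q.1 - q.2 ^ 3) ^ 2) ^ b) *
      ‖FT2 u q.1 q.2‖ₑ ^ 2 = ENNReal.ofReal (XnormI s N b u) ^ 2 := by
  obtain ⟨G, hG⟩ := exists_schwartzMap_eq_FT2 u
  obtain ⟨C, hC, h⟩ := G.exists_norm_le 5
  have hm := measurable_mI s N
  have hGm : Measurable G := G.continuous.measurable
  have hpos (q : ℝ × ℝ) : 0 ≤ mI s N q.2 ^ 2 * (1 + (q.1 - q.2 ^ 3) ^ 2) ^ b * ‖G q‖ ^ 2 := by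
    positivity
  have hInt : Integrable fun q : ℝ × ℝ =>
      mI s N q.2 ^ 2 * (1 + (q.1 - q.2 ^ 3) ^ 2) ^ b * ‖G q‖ ^ 2 := by
    refine ((integrable_one_add_norm (E := ℝ × ℝ) (r := 4)
      (by norm_num [Module.finrank_prod])).const_mul (C ^ 2)).mono'
      (Measurable.aestronglyMeasurable (by fun_prop)) (ae_of_all _ fun q => ?_)
    rw [Real.norm_of_nonneg (hpos q)]
    have hq := norm_nonneg q
    have h1 : mI s N q.2 ^ 2 ≤ 1 := pow_le_one₀ (mI_pos hN q.2).le (mI_le_one hs hN q.2)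
    have h2 : (1 + (q.1 - q.2 ^ 3) ^ 2) ^ b ≤ (1 + ‖q‖) ^ 6 := by
      have ha : |q.1| ≤ ‖q‖ := norm_fst_le q
      have hb' : |q.2| ≤ ‖q‖ := norm_snd_le q
      calc (1 + (q.1 - q.2 ^ 3) ^ 2) ^ b ≤ (1 + (q.1 - q.2 ^ 3) ^ 2) ^ (1 : ℝ) :=
            Real.rpow_le_rpow_of_exponent_le (le_add_of_nonneg_right (sq_nonneg _)) hb
        _ = 1 + |q.1 - q.2 ^ 3| ^ 2 := by rw [Real.rpow_one, sq_abs]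
        _ ≤ 1 + (‖q‖ + ‖q‖ ^ 3) ^ 2 := by
            gcongr
            refine (abs_sub _ _).trans (add_le_add ha ?_)
            rw [abs_pow]; gcongr
        _ ≤ _ := by
            generalize ‖q‖ = x at *
            have : 0 ≤ 6 * x + 14 * x ^ 2 + 20 * x ^ 3 + 13 * x ^ 4 + 6 * x ^ 5 := by positivity
            nlinarith
    calc _ ≤ 1 * (1 + ‖q‖) ^ 6 * ‖G q‖ ^ 2 := by gcongr
      _ = ((1 + ‖q‖) ^ 5 * ‖G q‖) ^ 2 * (1 + ‖q‖) ^ (-4 : ℝ) := by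
          rw [Real.rpow_neg (by positivity), ← div_eq_mul_inv, eq_div_iff (by positivity)]
          norm_cast
          ring
      _ ≤ C ^ 2 * (1 + ‖q‖) ^ (-4 : ℝ) := by gcongr; exact h q
  have hX : XnormI s N b u = √(∫ q : ℝ × ℝ,
      mI s N q.2 ^ 2 * (1 + (q.1 - q.2 ^ 3) ^ 2) ^ b * ‖G q‖ ^ 2) := by
    simp_rw [hG]; rfl
  rw [hX, ← ENNReal.ofReal_pow (Real.sqrt_nonneg _), Real.sq_sqrt (integral_nonneg hpos),
    ofReal_integral_eq_lintegral_ofReal hInt (ae_of_all _ hpos)]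
  refine lintegral_congr fun q => ?_
  rw [ENNReal.ofReal_mul (q := ‖G q‖ ^ 2) (by positivity), ENNReal.ofReal_pow (norm_nonneg _),
    ofReal_norm, hG]

/-- The integrand of the quintic form `Lam 5 M` of the time slices of `u`, with the modulations
`l` of the five factors as additional variables and the oscillating factor removed. -/
def modForm (M : (Fin 5 → ℝ) → ℂ) (u : ℝ × ℝ → ℂ) (z : (Fin 4 → ℝ) × (Fin 5 → ℝ)) : ℂ :=
  M (padZero 5 z.1) * ∏ j, FT2 u (padZero 5 z.1 j ^ 3 + z.2 j) (padZero 5 z.1 j)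

/-- The sum of the time frequencies of the five factors. -/
def modPhase (z : (Fin 4 → ℝ) × (Fin 5 → ℝ)) : ℝ :=
  ∑ j, padZero 5 z.1 j ^ 3 + ∑ j, z.2 j

@[fun_prop]
lemma measurable_modPhase : Measurable modPhase := by
  have := measurable_padZero 5
  unfold modPhase
  fun_prop

lemma measurable_modForm {M : (Fin 5 → ℝ) → ℂ} (hM : Measurable M) {u : ℝ × ℝ → ℂ}
    (hu : Measurable fun q : ℝ × ℝ => FT2 u q.1 q.2) : Measurable (modForm M u) := by
  have hp := measurable_padZero 5
  unfold modForm
  refine Measurable.mul (by fun_prop) (Finset.measurable_fun_prod _ fun j _ => ?_)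
  exact hu.comp (f := fun z : (Fin 4 → ℝ) × (Fin 5 → ℝ) =>
    (padZero 5 z.1 j ^ 3 + z.2 j, padZero 5 z.1 j)) (by fun_prop)

lemma Lam_slice_eq {M : (Fin 5 → ℝ) → ℂ} (u : SchwartzMap (ℝ × ℝ) ℂ)
    (hM : Integrable (modForm M u)) (σ : ℝ) :
    Lam 5 M (fun x => u (σ, x)) = (((2 * Real.pi)⁻¹ : ℝ) : ℂ) ^ 5 *
      ∫ z, Complex.exp (Complex.I * ((σ * modPhase z : ℝ) : ℂ)) * modForm M u z := by
  have hInt : Integrable (fun z => Complex.exp (Complex.I * ((σ * modPhase z : ℝ) : ℂ)) *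
      modForm M u z) (volume.prod volume) := by
    refine Integrable.bdd_mul (c := 1) hM
      (Measurable.aestronglyMeasurable (by fun_prop)) (ae_of_all _ fun p => ?_)
    rw [mul_comm]; exact (Complex.norm_exp_ofReal_mul_I _).le
  rw [Measure.volume_eq_prod (Fin 4 → ℝ) (Fin 5 → ℝ), integral_prod _ hInt, ← integral_const_mul]
  unfold Lam
  refine congrArg (integral volume) (funext fun v => ?_)
  rw [Finset.prod_congr rfl fun j _ => FTs_slice_eq u σ (padZero 5 v j), Finset.prod_mul_distrib,
    Finset.prod_const, Finset.card_univ, Fintype.card_fin,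
    ← integral_fintype_prod_volume_eq_prod (fun j l => Complex.exp (Complex.I *
      ((σ * (padZero 5 v j ^ 3 + l) : ℝ) : ℂ)) * FT2 u (padZero 5 v j ^ 3 + l) (padZero 5 v j)),
    mul_left_comm, ← integral_const_mul]
  congr 1
  refine congrArg (integral volume) (funext fun l => ?_)
  simp only [modForm, modPhase]
  rw [Finset.prod_mul_distrib, ← Complex.exp_sum, mul_left_comm]
  congr 2
  rw [← Finset.sum_add_distrib, Finset.mul_sum, Complex.ofReal_sum, Finset.mul_sum]

/-- The multiplier of the quintic form, restricted to small values of the resonance function. -/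
def lowResMultiplier (s N K : ℝ) (ξ : Fin 5 → ℝ) : ℂ :=
  if |∑ j, (ξ j) ^ 3| < K then ((∑ j, mI s N (ξ j) ^ 2 * ξ j : ℝ) : ℂ) else 0

lemma measurable_lowResMultiplier (s N K : ℝ) : Measurable (lowResMultiplier s N K) := by
  have hm := measurable_mI s N
  unfold lowResMultiplier
  refine Measurable.ite (measurableSet_lt (by fun_prop) measurable_const) ?_ measurable_const
  fun_prop

lemma timeWeight_mul_enorm_modForm (s N K ε : ℝ) (u : ℝ × ℝ → ℂ)
    (z : (Fin 4 → ℝ) × (Fin 5 → ℝ)) :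
    3 * timeWeight ε (modPhase z) * ‖modForm (lowResMultiplier s N K) u z‖ₑ =
      modWeight ε K (∑ j, z.2 j) (∑ j, padZero 5 z.1 j ^ 3) *
        ENNReal.ofReal |∑ j, mI s N (padZero 5 z.1 j) ^ 2 * padZero 5 z.1 j| *
          ∏ j, ‖FT2 u (padZero 5 z.1 j ^ 3 + z.2 j) (padZero 5 z.1 j)‖ₑ := by
  have hprod : ‖∏ j, FT2 u (padZero 5 z.1 j ^ 3 + z.2 j) (padZero 5 z.1 j)‖ₑ =
      ∏ j, ‖FT2 u (padZero 5 z.1 j ^ 3 + z.2 j) (padZero 5 z.1 j)‖ₑ := by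
    simp only [← ofReal_norm, norm_prod]
    rw [ENNReal.ofReal_prod_of_nonneg fun _ _ => norm_nonneg _]
  rw [modForm, enorm_mul, hprod, ← mul_assoc]
  congr 1
  unfold lowResMultiplier modWeight modPhase
  by_cases h : |∑ j, padZero 5 z.1 j ^ 3| < K
  · have h' : ∑ j, padZero 5 z.1 j ^ 3 ∈ Set.Ioo (-K) K := abs_lt.1 h
    rw [if_pos h, Set.indicator_of_mem h', ← ofReal_norm (_ : ℂ), Complex.norm_real,
      Real.norm_eq_abs]
  · have h' : ∑ j, padZero 5 z.1 j ^ 3 ∉ Set.Ioo (-K) K := fun h' => h (abs_lt.2 h')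
    rw [if_neg h, Set.indicator_of_notMem h', enorm_zero, mul_zero, zero_mul]

lemma lintegral_modForm_le {s N K ε C : ℝ} (hs : -(1 / 6) ≤ s) (hs0 : s ≤ 0) (hN : 0 < N)
    (hC : ∀ l : ℝ, formConst s N K (modWeight ε K l) ≤ ENNReal.ofReal C)
    {u : ℝ × ℝ → ℂ} (hu : Measurable fun q : ℝ × ℝ => FT2 u q.1 q.2) :
    ∫⁻ z, 3 * timeWeight ε (modPhase z) * ‖modForm (lowResMultiplier s N K) u z‖ₑ ≤
      60000 * ENNReal.ofReal C *
        (∫⁻ l, cubicSliceNorm s N (fun q => ‖FT2 u q.1 q.2‖ₑ) l) ^ 5 := by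
  have hF := measurable_modForm (measurable_lowResMultiplier s N K) hu
  refine le_trans (le_of_eq ?_) (lintegral_resonant_form_le hs hs0 hN hC hu.enorm)
  change ∫⁻ z, _ ∂(volume.prod volume) = _
  rw [lintegral_prod_symm' _ (by fun_prop)]
  exact lintegral_congr fun l => lintegral_congr fun v =>
    timeWeight_mul_enorm_modForm s N K ε u (v, l)

lemma exists_enorm_integral_Lam_le {s ε b : ℝ} (hs : -(1 / 6) < s) (hs0 : s ≤ 0) (hε : 0 ≤ ε)
    (hε1 : 2 * ε < 1) (hb : 1 / 2 < b) (hb1 : b ≤ 1) :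
    ∃ C : ℝ, 0 < C ∧ ∀ N K t : ℝ, 0 < N → 0 < K → 0 < t → t ≤ 1 →
      ∀ u : SchwartzMap (ℝ × ℝ) ℂ,
        ‖∫ σ in (0 : ℝ)..t, Lam 5 (lowResMultiplier s N K) (fun x => u (σ, x))‖ ≤
          C * N ^ (-(1 / 2) : ℝ) * K ^ (1 - ε) * XnormI s N b u ^ 5 := by
  obtain ⟨C₁, hC₁, h₁⟩ := exists_formConst_le hs hε hε1
  obtain ⟨C₀, hC₀, h₀⟩ := exists_formConst_le hs le_rfl (by norm_num : 2 * (0 : ℝ) < 1)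
  obtain ⟨C₂, hC₂, h₂⟩ := exists_lintegral_cubicSliceNorm_le hb
  refine ⟨60000 * C₁ * C₂ ^ 5, by positivity, fun N K t hN hK ht ht1 u => ?_⟩
  obtain ⟨G, hG⟩ := exists_schwartzMap_eq_FT2 u
  have hu : Measurable fun q : ℝ × ℝ => FT2 u q.1 q.2 := by
    simp_rw [← hG]; exact G.continuous.measurable
  have hX0 : 0 ≤ XnormI s N b u := Real.sqrt_nonneg _
  have hA : ∫⁻ l, cubicSliceNorm s N (fun q => ‖FT2 u q.1 q.2‖ₑ) l ≤
      ENNReal.ofReal (C₂ * XnormI s N b u) := by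
    refine (h₂ s N _ hN hu.enorm).trans (le_of_eq ?_)
    rw [lintegral_eq_XnormI_sq hs0 hN hb1, ← ENNReal.rpow_natCast, ← ENNReal.rpow_mul,
      ENNReal.ofReal_mul hC₂.le]
    norm_num
  have hF (a C : ℝ) (hC : ∀ l : ℝ, formConst s N K (modWeight a K l) ≤ ENNReal.ofReal C)
      (hC0 : 0 ≤ C) :
      ∫⁻ z, 3 * timeWeight a (modPhase z) * ‖modForm (lowResMultiplier s N K) u z‖ₑ ≤
        ENNReal.ofReal (60000 * C * (C₂ * XnormI s N b u) ^ 5) := by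
    refine (lintegral_modForm_le hs.le hs0 hN hC hu).trans ?_
    rw [ENNReal.ofReal_mul (by positivity), ENNReal.ofReal_mul (by positivity),
      ENNReal.ofReal_pow (by positivity), ENNReal.ofReal_ofNat]
    gcongr
  have hmeas := measurable_modForm (measurable_lowResMultiplier s N K) hu
  have hInt : Integrable (modForm (lowResMultiplier s N K) u) := by
    refine ⟨hmeas.aestronglyMeasurable, lt_of_le_of_lt (lintegral_mono fun z => ?_)
      ((hF 0 _ (fun l => h₀ N K l hN hK) (by positivity)).trans_lt ENNReal.ofReal_lt_top)⟩
    have h3 : timeWeight 0 (modPhase z) = 1 := by simp [timeWeight]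
    rw [h3, mul_one]
    exact le_mul_of_one_le_left zero_le (by norm_num)
  have hmain := (enorm_integral_integral_exp_mul_le hInt measurable_modPhase ht ht1
    (ε := ε) (by linarith)).trans (hF ε _ (fun l => h₁ N K l hN hK) (by positivity))
  rw [← ofReal_norm, ENNReal.ofReal_le_ofReal_iff (by positivity)] at hmain
  simp_rw [Lam_slice_eq u hInt]
  rw [intervalIntegral.integral_const_mul, norm_mul]
  have hpi : ‖(((2 * Real.pi)⁻¹ : ℝ) : ℂ) ^ 5‖ ≤ 1 := by
    rw [norm_pow, Complex.norm_real, Real.norm_of_nonneg (by positivity)]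
    exact pow_le_one₀ (by positivity) (inv_le_one_of_one_le₀ (by linarith [Real.pi_gt_three]))
  refine (mul_le_of_le_one_left (norm_nonneg _) hpi).trans (hmain.trans (le_of_eq ?_))
  ring

theorem Lambda5_term_control (s : ℝ) (hs : -1/6 < s) (hs0 : s < 0) :
    ∃ ε₀ > 0, ∀ ε : ℝ, 0 < ε → ε < ε₀ →
      ∃ b : ℝ, 1/2 < b ∧ b < 1 ∧ ∃ C > 0,
        ∀ N : ℝ, 1 ≤ N → ∀ K : ℝ, 0 < K → ∀ t : ℝ, 0 < t → t ≤ 1 →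
          ∀ u : SchwartzMap (ℝ × ℝ) ℂ,
            ‖∫ σ in (0:ℝ)..t,
                Lam 5 (fun ξ => if |∑ j, (ξ j) ^ 3| < K then
                    ((∑ j, mI s N (ξ j) ^ 2 * ξ j : ℝ) : ℂ) else 0)
                  (fun x => u (σ, x))‖ ≤
              C * N ^ (-(1:ℝ)/2 + ε) * K ^ (1 - ε) * XnormI s N b (⇑u) ^ 5 := by
  refine ⟨1 / 4, by norm_num, fun ε hε hε1 => ⟨3 / 4, by norm_num, by norm_num, ?_⟩⟩
  obtain ⟨C, hC, h⟩ := exists_enorm_integral_Lam_le (s := s) (ε := ε) (b := 3 / 4) (by linarith)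
    hs0.le hε.le (by linarith) (by norm_num) (by norm_num)
  refine ⟨C, hC, fun N hN K hK t ht ht1 u => (h N K t (by linarith) hK ht ht1 u).trans ?_⟩
  have hX0 : 0 ≤ XnormI s N (3 / 4) u := Real.sqrt_nonneg _
  gcongr
  linarith

end
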